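/- arXiv:2509.04108 — 3 statements merged into one kernel-verified Lean document; each statement's English description precedes it below -/
import Mathlib

section
/- (Convexity of volume along linear parameter systems, planar convex hull case) Let x₁,...,x_N ∈ ℝⁿ, λ₁,...,λ_N ∈ ℝ, and u ∈ S^{n-1}. Define K(t) = conv{ x_j + λ_j t u : 1 ≤ j ≤ N } for t ∈ ℝ. Then the function t ↦ |K(t)| (n-dimensional Lebesgue measure of K(t)) is convex on ℝ. -/
open MeasureTheory

/-- The length of the image of a compact convex set under a continuous linear functional is a
convex function of the functional. -/
theorem volume_image_combo_le {V : Type*} [AddCommGroup V] [Module ℝ V] [TopologicalSpace V]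
    {S : Set V} (hS : IsCompact S) (hconv : Convex ℝ S) (f g : V →L[ℝ] ℝ) {a b : ℝ}
    (ha : 0 ≤ a) (hb : 0 ≤ b) :
    volume ((fun v => a * f v + b * g v) '' S) ≤
      ENNReal.ofReal a * volume (f '' S) + ENNReal.ofReal b * volume (g '' S) := by
  rcases S.eq_empty_or_nonempty with rfl | hne
  · simp
  have hcont : Continuous fun v => a * f v + b * g v := by fun_prop
  obtain ⟨p, hp, hpmin⟩ := hS.exists_isMinOn hne hcont.continuousOn
  obtain ⟨q, hq, hqmax⟩ := hS.exists_isMaxOn hne hcont.continuousOn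
  have hlen : ∀ h : V →L[ℝ] ℝ, ENNReal.ofReal (h q - h p) ≤ volume (h '' S) := by
    intro h
    rw [← Real.volume_Icc]
    refine measure_mono ?_
    exact (hconv.linear_image (h : V →ₗ[ℝ] ℝ)).ordConnected.out
      (Set.mem_image_of_mem _ hp) (Set.mem_image_of_mem _ hq)
  calc volume ((fun v => a * f v + b * g v) '' S)
      ≤ volume (Set.Icc (a * f p + b * g p) (a * f q + b * g q)) := by
        refine measure_mono ?_
        rintro _ ⟨v, hv, rfl⟩
        exact ⟨hpmin hv, hqmax hv⟩
    _ = ENNReal.ofReal (a * (f q - f p) + b * (g q - g p)) := by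
        rw [Real.volume_Icc]; congr 1; ring
    _ ≤ ENNReal.ofReal (a * (f q - f p)) + ENNReal.ofReal (b * (g q - g p)) :=
        ENNReal.ofReal_add_le
    _ ≤ _ := by
        rw [ENNReal.ofReal_mul ha, ENNReal.ofReal_mul hb]
        gcongr
        · exact hlen f
        · exact hlen g

theorem convexHull_range_eq_image_stdSimplex {E ι : Type*} [AddCommGroup E] [Module ℝ E]
    [Fintype ι] (p : ι → E) :
    convexHull ℝ (Set.range p) = (fun w : ι → ℝ => ∑ i, w i • p i) '' stdSimplex ℝ ι := by
  classical
  have h := (Fintype.linearCombination ℝ p).image_convexHull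
    (Set.range fun i j : ι => if i = j then (1 : ℝ) else 0)
  rw [convexHull_basis_eq_stdSimplex, ← Set.range_comp] at h
  have hp : (Fintype.linearCombination ℝ p ∘ fun i j : ι => if i = j then (1 : ℝ) else 0) = p := by
    ext i
    simp [Fintype.linearCombination_apply]
  rw [hp] at h
  rw [← h]
  rfl

section

variable {E ι : Type*} [NormedAddCommGroup E] [InnerProductSpace ℝ E] [Fintype ι]

/-- On each line parallel to `u`, the length of the section of a linear parameter system in
direction `u` is a convex function of the parameter. -/
theorem volume_section_lps_combo_le (x : ι → E) (l : ι → ℝ) {u : E} (hu : ‖u‖ = 1)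
    {y : E} (hy : inner ℝ u y = 0) (s t : ℝ) {a b : ℝ} (ha : 0 ≤ a) (hb : 0 ≤ b)
    (hab : a + b = 1) :
    volume {r : ℝ | r • u + y ∈
        convexHull ℝ (Set.range fun j => x j + (l j * (a * s + b * t)) • u)} ≤
      ENNReal.ofReal a * volume {r : ℝ | r • u + y ∈
        convexHull ℝ (Set.range fun j => x j + (l j * s) • u)} +
      ENNReal.ofReal b * volume {r : ℝ | r • u + y ∈
        convexHull ℝ (Set.range fun j => x j + (l j * t) • u)} := by
  let X : (ι → ℝ) →ₗ[ℝ] E := Fintype.linearCombination ℝ x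
  let Λ : (ι → ℝ) →ₗ[ℝ] ℝ := Fintype.linearCombination ℝ l
  let h : (ι → ℝ) →ₗ[ℝ] ℝ := (innerSL ℝ u).toLinearMap ∘ₗ X
  let P : (ι → ℝ) →ₗ[ℝ] E := X - h.smulRight u
  let S : Set (ι → ℝ) := stdSimplex ℝ ι ∩ P ⁻¹' {y}
  have hS : IsCompact S := (isCompact_stdSimplex ℝ ι).inter_right
    (isClosed_singleton.preimage P.continuous_on_pi)
  have hconv : Convex ℝ S :=
    (convex_stdSimplex ℝ ι).inter ((convex_singleton y).linear_preimage P)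
  have huu : inner ℝ u u = (1 : ℝ) := by rw [real_inner_self_eq_norm_sq, hu]; norm_num
  have hsum : ∀ (τ : ℝ) (w : ι → ℝ),
      ∑ j, w j • (x j + (l j * τ) • u) = X w + (τ * Λ w) • u := by
    intro τ w
    simp only [X, Λ, Fintype.linearCombination_apply, smul_add, Finset.sum_add_distrib, smul_smul,
      Finset.mul_sum, Finset.sum_smul, smul_eq_mul]
    congr 1
    exact Finset.sum_congr rfl fun j _ => by congr 1; ring
  have key : ∀ τ : ℝ, {r : ℝ | r • u + y ∈
      convexHull ℝ (Set.range fun j => x j + (l j * τ) • u)} =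
      (fun w => h w + τ * Λ w) '' S := by
    intro τ
    ext r
    simp only [convexHull_range_eq_image_stdSimplex, hsum, Set.mem_ofPred_eq, Set.mem_image]
    constructor
    · rintro ⟨w, hw, hr⟩
      have hin : h w + τ * Λ w = r := by
        have := congrArg (inner ℝ u) hr
        rw [inner_add_right, inner_add_right, inner_smul_right, inner_smul_right, huu, hy, mul_one,
          mul_one, add_zero] at this
        exact this
      refine ⟨w, ⟨hw, ?_⟩, hin⟩
      change X w - h w • u = y
      rw [← hin, add_smul] at hr
      rw [sub_eq_iff_eq_add]
      refine add_right_cancel (hr.trans ?_)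
      abel
    · rintro ⟨w, ⟨hw, hP⟩, rfl⟩
      refine ⟨w, hw, ?_⟩
      change X w - h w • u = y at hP
      rw [← hP, add_smul]
      abel
  let F : ℝ → (ι → ℝ) →L[ℝ] ℝ := fun τ => LinearMap.toContinuousLinearMap (h + τ • Λ)
  have hF : ∀ τ w, F τ w = h w + τ * Λ w := fun τ w => rfl
  have hmain := volume_image_combo_le hS hconv (F s) (F t) ha hb
  rw [key, key, key]
  have hfun : (fun w => h w + (a * s + b * t) * Λ w) = fun w => a * F s w + b * F t w := by
    funext w
    rw [hF, hF]
    linear_combination (-(h w)) * hab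
  rw [hfun]
  exact hmain

/-- Cavalieri's principle along the direction of a nonzero vector, up to a constant. -/
theorem exists_addHaar_eq_lintegral_section [FiniteDimensional ℝ E] [MeasurableSpace E]
    [BorelSpace E] (μ : Measure E) [μ.IsAddHaarMeasure] {u : E} (hu : u ≠ 0) :
    ∃ c : ENNReal, ∀ K : Set E, MeasurableSet K →
      μ K = c * ∫⁻ y : (ℝ ∙ u)ᗮ, volume {r : ℝ | r • u + (y : E) ∈ K} := by
  let e : (ℝ × (ℝ ∙ u)ᗮ) ≃L[ℝ] E :=
    (((LinearEquiv.toSpanNonzeroSingleton ℝ E u hu).prodCongr (LinearEquiv.refl ℝ _)).trans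
      ((ℝ ∙ u).prodEquivOfIsCompl _ (ℝ ∙ u).isCompl_orthogonal)).toContinuousLinearEquiv
  have he : ∀ r y, e (r, y) = r • u + (y : E) := fun r y => by simp [e]
  obtain ⟨c, hc⟩ : ∃ c : NNReal, μ.map e.symm = c • (volume.prod volume) :=
    ⟨_, Measure.isAddLeftInvariant_eq_smul _ _⟩
  refine ⟨c, fun K hK => ?_⟩
  have hpre : MeasurableSet (e ⁻¹' K) := e.continuous.measurable hK
  have hμ : μ K = μ.map e.symm (e ⁻¹' K) := by
    rw [Measure.map_apply e.symm.continuous.measurable hpre, ← Set.preimage_comp]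
    simp
  rw [hμ, hc, Measure.smul_apply, Measure.prod_apply_symm hpre]
  simp only [Set.preimage, he, Set.mem_ofPred_eq]
  rfl

/-- Convexity of the Haar measure along a linear parameter system. -/
theorem addHaar_convexHull_lps_combo_le [FiniteDimensional ℝ E] [MeasurableSpace E]
    [BorelSpace E] (μ : Measure E) [μ.IsAddHaarMeasure] (x : ι → E) (l : ι → ℝ) {u : E}
    (hu : ‖u‖ = 1) (s t : ℝ) {a b : ℝ} (ha : 0 ≤ a) (hb : 0 ≤ b) (hab : a + b = 1) :
    μ (convexHull ℝ (Set.range fun j => x j + (l j * (a * s + b * t)) • u)) ≤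
      ENNReal.ofReal a * μ (convexHull ℝ (Set.range fun j => x j + (l j * s) • u)) +
      ENNReal.ofReal b * μ (convexHull ℝ (Set.range fun j => x j + (l j * t) • u)) := by
  obtain ⟨c, hc⟩ := exists_addHaar_eq_lintegral_section μ (norm_ne_zero_iff.1 (hu ▸ one_ne_zero))
  have hmeas : ∀ τ : ℝ, MeasurableSet (convexHull ℝ (Set.range fun j => x j + (l j * τ) • u)) :=
    fun τ => ((Set.finite_range _).isClosed_convexHull ℝ).measurableSet
  have hsec : ∀ τ : ℝ, Measurable fun y : (ℝ ∙ u)ᗮ => volume {r : ℝ | r • u + (y : E) ∈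
      convexHull ℝ (Set.range fun j => x j + (l j * τ) • u)} := by
    intro τ
    have hcont : Continuous fun p : ℝ × (ℝ ∙ u)ᗮ => p.1 • u + (p.2 : E) := by fun_prop
    exact measurable_measure_prodMk_right (hcont.measurable (hmeas τ))
  rw [hc _ (hmeas _), hc _ (hmeas s), hc _ (hmeas t), mul_left_comm, mul_left_comm _ c, ← mul_add,
    ← lintegral_const_mul _ (hsec s), ← lintegral_const_mul _ (hsec t),
    ← lintegral_add_left ((hsec s).const_mul _)]
  gcongr with y
  exact volume_section_lps_combo_le x l hu
    (Submodule.mem_orthogonal_singleton_iff_inner_right.1 y.2)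
    s t ha hb hab

end

/-- (Convexity of volume along linear parameter systems, convex hull case.)
For points `x₁,…,x_N ∈ ℝⁿ`, speeds `λ₁,…,λ_N ∈ ℝ` and a unit direction `u`, the volume of
`K(t) = conv{ x_j + λ_j t u }` is a convex function of `t`. -/
theorem volume_convexHull_lps_convexOn {n N : ℕ}
    (x : Fin N → EuclideanSpace ℝ (Fin n)) (l : Fin N → ℝ)
    (u : EuclideanSpace ℝ (Fin n)) (hu : ‖u‖ = 1) :
    ConvexOn ℝ Set.univ (fun t : ℝ =>
      (volume (convexHull ℝ (Set.range fun j : Fin N => x j + (l j * t) • u))).toReal) := by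
  refine ⟨convex_univ, fun s _ t _ a b ha hb hab => ?_⟩
  have hfin : ∀ τ : ℝ,
      volume (convexHull ℝ (Set.range fun j : Fin N => x j + (l j * τ) • u)) ≠ ⊤ :=
    fun τ => ((Set.finite_range _).isCompact_convexHull ℝ).measure_ne_top
  have hle := addHaar_convexHull_lps_combo_le volume x l hu s t ha hb hab
  have hs := ENNReal.mul_ne_top (ENNReal.ofReal_ne_top (r := a)) (hfin s)
  have ht := ENNReal.mul_ne_top (ENNReal.ofReal_ne_top (r := b)) (hfin t)
  have := ENNReal.toReal_mono (ENNReal.add_ne_top.2 ⟨hs, ht⟩) hle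
  rwa [ENNReal.toReal_add hs ht, ENNReal.toReal_mul, ENNReal.toReal_mul, ENNReal.toReal_ofReal ha,
    ENNReal.toReal_ofReal hb] at this
end

section
/- (Functional quermassintegral inequality for rearranged superlevel sets in expectation, characteristic function case) Let K ⊂ ℝⁿ be a convex body, let X₁,...,X_N be independent random vectors uniformly distributed on K, and let X₁*,...,X_N* be independent random vectors uniformly distributed on the ball B_K of the same volume as K, centered at the origin. Let C ⊂ ℝ^N be a convex body contained in the nonnegative orthant. Then for every i ∈ {0,1,...,n−1}, E[W_i([X₁,...,X_N]C)] ≥ E[W_i([X₁*,...,X_N*]C)], where [x₁,...,x_N]C = { Σⱼ cⱼ xⱼ : c ∈ C }. -/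
open MeasureTheory
open scoped Pointwise BigOperators

/-- Mixed volume of an `n`-tuple of subsets of `ℝⁿ`, via the inclusion–exclusion
(polarization) formula for volumes of Minkowski sums. -/
noncomputable def mixedVol (n : ℕ) (K : Fin n → Set (EuclideanSpace ℝ (Fin n))) : ℝ :=
  ((n.factorial : ℝ))⁻¹ *
    ∑ S : Finset (Fin n), (-1 : ℝ) ^ (n - S.card) * (volume (∑ i ∈ S, K i)).toReal

/-- The `i`-th quermassintegral `W_i(K) = V(K[n-i], B[i])`. -/
noncomputable def quermass (n i : ℕ) (K : Set (EuclideanSpace ℝ (Fin n))) : ℝ :=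
  mixedVol n (fun j => if (j : ℕ) < n - i then K
    else Metric.closedBall (0 : EuclideanSpace ℝ (Fin n)) 1)

/-- The centered Euclidean ball `B_K` with the same volume as `K`. -/
noncomputable def ballSameVol (n : ℕ) (K : Set (EuclideanSpace ℝ (Fin n))) :
    Set (EuclideanSpace ℝ (Fin n)) :=
  Metric.closedBall 0
    (((volume K).toReal /
        (volume (Metric.closedBall (0 : EuclideanSpace ℝ (Fin n)) 1)).toReal) ^ (1 / (n : ℝ)))

section Fibers

variable {E : Type*} [NormedAddCommGroup E] [InnerProductSpace ℝ E]

/-- The fiber over `y ∈ θᗮ` of a set along the line with direction `θ`. -/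
def lineFiber (θ : E) (y : (ℝ ∙ θ)ᗮ) (L : Set E) : Set ℝ := {r | r • θ + (y : E) ∈ L}

theorem mem_lineFiber {θ : E} {y : (ℝ ∙ θ)ᗮ} {L : Set E} {r : ℝ} :
    r ∈ lineFiber θ y L ↔ r • θ + (y : E) ∈ L := Iff.rfl

theorem exists_eq_smul_add (θ x : E) : ∃ (r : ℝ) (y : (ℝ ∙ θ)ᗮ), x = r • θ + (y : E) := by
  obtain ⟨r, hr⟩ := Submodule.mem_span_singleton.1 ((ℝ ∙ θ).starProjection_apply_mem x)
  refine ⟨r, ⟨x - (ℝ ∙ θ).starProjection x, Submodule.sub_starProjection_mem_orthogonal x⟩, ?_⟩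
  simp [hr]

theorem smul_add_injective {θ : E} (hθ : θ ≠ 0) :
    Function.Injective fun p : ℝ × (ℝ ∙ θ)ᗮ => p.1 • θ + (p.2 : E) := by
  rintro ⟨r, y⟩ ⟨s, z⟩ h
  have hy := Submodule.mem_orthogonal_singleton_iff_inner_right.1 y.2
  have hz := Submodule.mem_orthogonal_singleton_iff_inner_right.1 z.2
  have h2 := congrArg (inner ℝ θ) h
  simp only [inner_add_right, inner_smul_right, hy, hz, add_zero] at h2
  have h3 : r = s := mul_right_cancel₀ (inner_self_ne_zero.2 hθ) h2
  subst h3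
  have h4 : (y : E) = z := by simpa using h
  simp [Subtype.ext h4]

theorem smul_add_eq_iff {θ : E} (hθ : θ ≠ 0) {r s : ℝ} {y z : (ℝ ∙ θ)ᗮ} :
    r • θ + (y : E) = s • θ + (z : E) ↔ r = s ∧ y = z := by
  constructor
  · intro h
    simpa using smul_add_injective hθ (a₁ := (r, y)) (a₂ := (s, z)) h
  · rintro ⟨rfl, rfl⟩; rfl

theorem isCompact_lineFiber {θ : E} (hθ : θ ≠ 0) {L : Set E} (hL : IsCompact L)
    (y : (ℝ ∙ θ)ᗮ) : IsCompact (lineFiber θ y L) :=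
  ((Homeomorph.addRight (y : E)).isClosedEmbedding.comp
    (isClosedEmbedding_smul_left hθ)).isCompact_preimage hL

theorem convex_lineFiber {θ : E} {L : Set E} (hL : Convex ℝ L) (y : (ℝ ∙ θ)ᗮ) :
    Convex ℝ (lineFiber θ y L) := by
  intro r hr s hs a b ha hb hab
  have := hL hr hs ha hb hab
  rw [mem_lineFiber]
  convert this using 1
  have hy : (y : E) = (a + b) • (y : E) := by rw [hab, one_smul]
  nth_rewrite 1 [hy]
  simp only [smul_eq_mul]
  module

theorem measure_eq_lintegral_lineFiber [MeasurableSpace E] {μ : Measure E} {θ : E}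
    {ν : Measure (ℝ ∙ θ)ᗮ} [SFinite ν]
    (h : MeasurePreserving (fun p : ℝ × (ℝ ∙ θ)ᗮ => p.1 • θ + (p.2 : E)) (volume.prod ν) μ)
    {L : Set E} (hL : MeasurableSet L) : μ L = ∫⁻ y, volume (lineFiber θ y L) ∂ν := by
  rw [← h.measure_preimage hL.nullMeasurableSet, Measure.prod_apply_symm (h.measurable hL)]
  rfl

variable [FiniteDimensional ℝ E] [MeasurableSpace E] [BorelSpace E]

theorem exists_measurePreserving_smul_add (μ : Measure E) [μ.IsAddHaarMeasure] {θ : E}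
    (hθ : θ ≠ 0) : ∃ ν : Measure (ℝ ∙ θ)ᗮ, ν.IsAddHaarMeasure ∧
      MeasurePreserving (fun p : ℝ × (ℝ ∙ θ)ᗮ => p.1 • θ + (p.2 : E)) (volume.prod ν) μ := by
  let f : (ℝ × (ℝ ∙ θ)ᗮ) →ₗ[ℝ] E :=
    { toFun := fun p => p.1 • θ + (p.2 : E)
      map_add' := by intro p q; simp only [Prod.fst_add, Prod.snd_add, Submodule.coe_add]; module
      map_smul' := by
        intro c p
        simp only [Prod.smul_fst, Prod.smul_snd, Submodule.coe_smul, smul_eq_mul,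
          RingHom.id_apply]
        module }
  have hf : Function.Bijective f := ⟨smul_add_injective hθ, fun x => by
    obtain ⟨r, y, h⟩ := exists_eq_smul_add θ x
    exact ⟨(r, y), h.symm⟩⟩
  let e : (ℝ × (ℝ ∙ θ)ᗮ) ≃L[ℝ] E := (LinearEquiv.ofBijective f hf).toContinuousLinearEquiv
  let ν₀ : Measure (ℝ ∙ θ)ᗮ := volume
  have h1 : (Measure.map e (volume.prod ν₀)).IsAddHaarMeasure := inferInstance
  have h := Measure.isAddLeftInvariant_eq_smul μ (Measure.map e (volume.prod ν₀))
  have hc := Measure.addHaarScalarFactor_pos_of_isAddHaarMeasure μ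
    (Measure.map e (volume.prod ν₀))
  set c := Measure.addHaarScalarFactor μ (Measure.map e (volume.prod ν₀))
  refine ⟨(c : ENNReal) • ν₀, Measure.IsAddHaarMeasure.smul _
    (by exact_mod_cast hc.ne') ENNReal.coe_ne_top, e.continuous.measurable, ?_⟩
  rw [Measure.prod_smul_right, Measure.map_smul, h]
  rfl

theorem measurable_volume_lineFiber (θ : E) {L : Set E} (hL : MeasurableSet L) :
    Measurable fun y : (ℝ ∙ θ)ᗮ => volume (lineFiber θ y L) := by
  have hm : Measurable fun p : ℝ × (ℝ ∙ θ)ᗮ => p.1 • θ + (p.2 : E) := by fun_prop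
  exact measurable_measure_prodMk_right (hm hL)

end Fibers

section Interval

theorem exists_eq_Icc {I : Set ℝ} (hI : IsCompact I) (hc : Convex ℝ I) (hne : I.Nonempty) :
    ∃ a b : ℝ, a ≤ b ∧ I = Set.Icc a b := by
  have h := eq_Icc_of_connected_compact ⟨hne, hc.isPreconnected⟩ hI
  refine ⟨_, _, ?_, h⟩
  rw [h] at hne
  exact Set.nonempty_Icc.1 hne

theorem volume_add_of_convex {I J : Set ℝ} (hI : IsCompact I) (hIc : Convex ℝ I)
    (hIn : I.Nonempty) (hJ : IsCompact J) (hJc : Convex ℝ J) (hJn : J.Nonempty) :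
    volume (I + J) = volume I + volume J := by
  obtain ⟨a, b, hab, rfl⟩ := exists_eq_Icc hI hIc hIn
  obtain ⟨c, d, hcd, rfl⟩ := exists_eq_Icc hJ hJc hJn
  rw [Set.Icc_add_Icc hab hcd]
  simp only [Real.volume_Icc]
  rw [← ENNReal.ofReal_add (by linarith) (by linarith)]
  congr 1; ring

end Interval

section CombImage

variable {N : ℕ}

/-- The set `[x₁,…,x_N]C` of all combinations `∑ cⱼ xⱼ` with coefficient vector in `C`. -/
def combImage {E : Type*} [AddCommGroup E] [Module ℝ E] (C : Set (Fin N → ℝ)) (x : Fin N → E) :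
    Set E := (fun c : Fin N → ℝ => ∑ j, c j • x j) '' C

theorem image_combImage {E F : Type*} [AddCommGroup E] [Module ℝ E] [AddCommGroup F] [Module ℝ F]
    (f : E →ₗ[ℝ] F) (C : Set (Fin N → ℝ)) (x : Fin N → E) :
    f '' combImage C x = combImage C (fun j => f (x j)) := by
  simp [combImage, Set.image_image]

theorem convex_combImage {E : Type*} [AddCommGroup E] [Module ℝ E] {C : Set (Fin N → ℝ)}
    (hC : Convex ℝ C) (x : Fin N → E) : Convex ℝ (combImage C x) := by
  have := hC.linear_image (∑ j, (LinearMap.proj j : (Fin N → ℝ) →ₗ[ℝ] ℝ).smulRight (x j))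
  convert this using 1
  ext
  simp [combImage]

theorem isCompact_combImage {E : Type*} [NormedAddCommGroup E] [NormedSpace ℝ E]
    {C : Set (Fin N → ℝ)} (hC : IsCompact C) (x : Fin N → E) : IsCompact (combImage C x) :=
  hC.image (by fun_prop)

end CombImage

section Projection

variable {E : Type*} [NormedAddCommGroup E] [InnerProductSpace ℝ E]

theorem orthogonalProjection_smul_add (θ : E) (r : ℝ) (y : (ℝ ∙ θ)ᗮ) :
    (ℝ ∙ θ)ᗮ.orthogonalProjectionOnto (r • θ + (y : E)) = y := by
  have h : (ℝ ∙ θ)ᗮ.orthogonalProjectionOnto θ = 0 :=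
    Submodule.orthogonalProjectionOnto_orthogonalComplement_singleton_eq_zero θ
  rw [map_add, map_smul, h]
  simp

theorem mem_image_orthogonalProjection_iff {θ : E} {L : Set E} {y : (ℝ ∙ θ)ᗮ} :
    y ∈ (ℝ ∙ θ)ᗮ.orthogonalProjectionOnto '' L ↔ (lineFiber θ y L).Nonempty := by
  constructor
  · rintro ⟨x, hx, rfl⟩
    obtain ⟨r, y, rfl⟩ := exists_eq_smul_add θ x
    exact ⟨r, by rwa [mem_lineFiber, orthogonalProjection_smul_add]⟩
  · rintro ⟨r, hr⟩
    exact ⟨_, hr, orthogonalProjection_smul_add θ r y⟩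

theorem isCompact_segment (u v : E) : IsCompact (segment ℝ u v) := by
  rw [segment_eq_image_lineMap]
  exact isCompact_Icc.image AffineMap.lineMap_continuous

theorem mem_segment_zero_smul {v x : E} {b : ℝ} (hb : 0 ≤ b) :
    x ∈ segment ℝ 0 (b • v) ↔ ∃ s ∈ Set.Icc 0 b, x = s • v := by
  rw [segment_eq_image]
  constructor
  · rintro ⟨t, ⟨h0, h1⟩, rfl⟩
    exact ⟨t * b, ⟨by positivity, by nlinarith⟩, by simp [smul_smul]⟩
  · rintro ⟨s, ⟨h0, h1⟩, rfl⟩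
    rcases hb.eq_or_lt with rfl | hb
    · exact ⟨0, by simp, by simp [le_antisymm h1 h0]⟩
    · refine ⟨s / b, ⟨by positivity, (div_le_one hb).2 h1⟩, ?_⟩
      simp [smul_smul, hb.ne']

theorem lineFiber_add_segment {θ : E} (hθ : θ ≠ 0) {b : ℝ} (hb : 0 ≤ b) (L : Set E)
    (y : (ℝ ∙ θ)ᗮ) :
    lineFiber θ y (L + segment ℝ 0 (b • θ)) = lineFiber θ y L + Set.Icc 0 b := by
  ext r
  rw [mem_lineFiber, Set.mem_add, Set.mem_add]
  constructor
  · rintro ⟨x, hx, z, hz, h⟩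
    obtain ⟨s, hs, rfl⟩ := (mem_segment_zero_smul hb).1 hz
    obtain ⟨r', y', rfl⟩ := exists_eq_smul_add θ x
    have : (r' + s) • θ + (y' : E) = r • θ + y := by rw [← h]; module
    obtain ⟨rfl, rfl⟩ := (smul_add_eq_iff hθ).1 this
    exact ⟨r', hx, s, hs, rfl⟩
  · rintro ⟨r', hr', s, hs, rfl⟩
    exact ⟨_, hr', s • θ, (mem_segment_zero_smul hb).2 ⟨s, hs, rfl⟩, by module⟩

variable [FiniteDimensional ℝ E] [MeasurableSpace E] [BorelSpace E]

theorem exists_measureReal_add_segment (μ : Measure E) [μ.IsAddHaarMeasure] {θ : E}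
    (hθ : θ ≠ 0) : ∃ ν : Measure (ℝ ∙ θ)ᗮ, ν.IsAddHaarMeasure ∧
      ∀ L : Set E, IsCompact L → Convex ℝ L → ∀ b : ℝ, 0 ≤ b →
        μ.real (L + segment ℝ 0 (b • θ)) =
          μ.real L + b * ν.real ((ℝ ∙ θ)ᗮ.orthogonalProjectionOnto '' L) := by
  obtain ⟨ν, hν, hmp⟩ := exists_measurePreserving_smul_add μ hθ
  refine ⟨ν, hν, fun L hL hLc b hb => ?_⟩
  have hP : IsCompact ((ℝ ∙ θ)ᗮ.orthogonalProjectionOnto '' L) := hL.image (by fun_prop)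
  have key : μ (L + segment ℝ 0 (b • θ)) =
      μ L + ENNReal.ofReal b * ν ((ℝ ∙ θ)ᗮ.orthogonalProjectionOnto '' L) := by
    rw [measure_eq_lintegral_lineFiber hmp (hL.add (isCompact_segment _ _)).measurableSet,
      measure_eq_lintegral_lineFiber hmp hL.measurableSet,
      ← lintegral_indicator_const hP.measurableSet,
      ← lintegral_add_left (measurable_volume_lineFiber θ hL.measurableSet)]
    refine lintegral_congr fun y => ?_
    rw [lineFiber_add_segment hθ hb]
    by_cases hy : (lineFiber θ y L).Nonempty
    · rw [Set.indicator_of_mem (mem_image_orthogonalProjection_iff.2 hy),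
        volume_add_of_convex (isCompact_lineFiber hθ hL y) (convex_lineFiber hLc y) hy
          isCompact_Icc (convex_Icc _ _) (Set.nonempty_Icc.2 hb)]
      simp
    · rw [Set.indicator_of_notMem (fun h => hy (mem_image_orthogonalProjection_iff.1 h)),
        Set.not_nonempty_iff_eq_empty.1 hy]
      simp
  rw [measureReal_def, key, ENNReal.toReal_add hL.measure_lt_top.ne
    (ENNReal.mul_ne_top ENNReal.ofReal_ne_top hP.measure_lt_top.ne), ENNReal.toReal_mul,
    ENNReal.toReal_ofReal hb]
  rfl

theorem two_mul_volume_le {I J M : Set ℝ} (hI : IsCompact I) (hIc : Convex ℝ I)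
    (hJ : IsCompact J) (hJc : Convex ℝ J) (h : ∀ m ∈ M, ∃ s, m + s ∈ I ∧ m - s ∈ J) :
    2 * volume M ≤ volume I + volume J := by
  rcases M.eq_empty_or_nonempty with rfl | ⟨m, hm⟩
  · simp
  obtain ⟨s, hs, hs'⟩ := h m hm
  rw [← volume_add_of_convex hI hIc ⟨_, hs⟩ hJ hJc ⟨_, hs'⟩]
  have h2 : volume ((2 : ℝ) • M) = 2 * volume M := by
    rw [Measure.addHaar_smul]; simp
  rw [← h2]
  refine measure_mono ?_
  rintro _ ⟨m, hm, rfl⟩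
  obtain ⟨s, hs, hs'⟩ := h m hm
  exact ⟨_, hs, _, hs', by simp; ring⟩

theorem two_mul_measure_combImage_le {N : ℕ} (μ : Measure E) [μ.IsAddHaarMeasure]
    {C : Set (Fin N → ℝ)} (hC : IsCompact C) (hCc : Convex ℝ C) (x : Fin N → E) (t : Fin N → ℝ)
    (θ : E) : 2 * μ.real (combImage C x) ≤ μ.real (combImage C fun j => x j + t j • θ) +
      μ.real (combImage C fun j => x j - t j • θ) := by
  rcases eq_or_ne θ 0 with rfl | hθ
  · simp [two_mul]
  obtain ⟨ν, hν, hmp⟩ := exists_measurePreserving_smul_add μ hθ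
  have hc (z : Fin N → E) := isCompact_combImage hC z
  have key : 2 * μ (combImage C x) ≤ μ (combImage C fun j => x j + t j • θ) +
      μ (combImage C fun j => x j - t j • θ) := by
    rw [measure_eq_lintegral_lineFiber hmp (hc _).measurableSet,
      measure_eq_lintegral_lineFiber hmp (hc _).measurableSet,
      measure_eq_lintegral_lineFiber hmp (hc _).measurableSet,
      ← lintegral_const_mul _ (measurable_volume_lineFiber θ (hc _).measurableSet),
      ← lintegral_add_left (measurable_volume_lineFiber θ (hc _).measurableSet)]
    refine lintegral_mono fun y => two_mul_volume_le
      (isCompact_lineFiber hθ (hc _) y) (convex_lineFiber (convex_combImage hCc _) y)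
      (isCompact_lineFiber hθ (hc _) y) (convex_lineFiber (convex_combImage hCc _) y) ?_
    rintro r ⟨c, hc, hr⟩
    refine ⟨∑ j, c j * t j, ⟨c, hc, ?_⟩, ⟨c, hc, ?_⟩⟩
    · simp only [smul_add, Finset.sum_add_distrib, smul_smul, ← Finset.sum_smul] at hr ⊢
      rw [hr]; module
    · simp only [smul_sub, Finset.sum_sub_distrib, smul_smul, ← Finset.sum_smul] at hr ⊢
      rw [hr]; module
  have hf (z : Fin N → E) : μ (combImage C z) ≠ ⊤ := (hc z).measure_lt_top.ne
  have := ENNReal.toReal_mono (ENNReal.add_ne_top.2 ⟨hf _, hf _⟩) key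
  rwa [ENNReal.toReal_mul, ENNReal.toReal_add (hf _) (hf _)] at this

end Projection

section SegDiff

/-- The iterated difference of the volume of a set under adding the segments `[0, v]`, for `v` in
a list. -/
noncomputable def segDiff {E : Type*} [NormedAddCommGroup E] [InnerProductSpace ℝ E]
    [MeasurableSpace E] (μ : Measure E) : List E → Set E → ℝ
  | [], L => μ.real L
  | v :: vs, L => segDiff μ vs (L + segment ℝ 0 v) - segDiff μ vs L

/-- The Minkowski sum of the segments `[0, v]`, for `v` in a list. -/
def zonotope {E : Type*} [NormedAddCommGroup E] [InnerProductSpace ℝ E] (vs : List E) : Set E :=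
  (vs.map (segment ℝ 0)).sum

theorem measureReal_add_zonotope {E : Type*} [NormedAddCommGroup E] [InnerProductSpace ℝ E]
    [MeasurableSpace E] (μ : Measure E) (vs : List E) (L : Set E) :
    μ.real (L + zonotope vs) = (vs.sublists'.map fun ws => segDiff μ ws L).sum := by
  induction vs generalizing L with
  | nil => simp [zonotope, segDiff]
  | cons v vs ih =>
    have : L + zonotope (v :: vs) = (L + segment ℝ 0 v) + zonotope vs := by
      simp [zonotope, add_assoc]
    rw [this, ih]
    simp only [List.sublists'_cons, List.map_append, List.map_map, List.sum_append,
      ← List.sum_map_add]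
    congr 2
    ext ws
    simp [segDiff]

theorem exists_segDiff_cons {E : Type*} [NormedAddCommGroup E] [InnerProductSpace ℝ E]
    [FiniteDimensional ℝ E] [MeasurableSpace E] [BorelSpace E] (μ : Measure E)
    [μ.IsAddHaarMeasure] {θ : E} (hθ : θ ≠ 0) : ∃ ν : Measure (ℝ ∙ θ)ᗮ, ν.IsAddHaarMeasure ∧
      ∀ (ws : List E) (L : Set E), IsCompact L → Convex ℝ L → ∀ b : ℝ, 0 ≤ b →
        segDiff μ ((b • θ) :: ws) L = b * segDiff ν (ws.map (ℝ ∙ θ)ᗮ.orthogonalProjectionOnto)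
          ((ℝ ∙ θ)ᗮ.orthogonalProjectionOnto '' L) := by
  obtain ⟨ν, hν, h⟩ := exists_measureReal_add_segment μ hθ
  refine ⟨ν, hν, fun ws => ?_⟩
  induction ws with
  | nil =>
    intro L hL hLc b hb
    simp [segDiff, h L hL hLc b hb]
  | cons w ws ih =>
    intro L hL hLc b hb
    have h1 := ih (L + segment ℝ 0 w) (hL.add (isCompact_segment _ _))
      (hLc.add (convex_segment _ _)) b hb
    have h2 := ih L hL hLc b hb
    have h3 : (ℝ ∙ θ)ᗮ.orthogonalProjectionOnto '' (L + segment ℝ 0 w) =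
        (ℝ ∙ θ)ᗮ.orthogonalProjectionOnto '' L +
          segment ℝ 0 ((ℝ ∙ θ)ᗮ.orthogonalProjectionOnto w) := by
      rw [Set.image_add]
      congr 1
      have := image_segment ℝ (ℝ ∙ θ)ᗮ.orthogonalProjectionOnto.toLinearMap.toAffineMap 0 w
      simpa using this
    simp only [segDiff, List.map_cons] at h1 h2 ⊢
    rw [h3] at h1
    rw [add_right_comm] at h1
    linear_combination h1 - h2

universe u

theorem segDiff_smul (k : ℕ) : ∀ {E : Type u} [NormedAddCommGroup E] [InnerProductSpace ℝ E]
    [FiniteDimensional ℝ E] [MeasurableSpace E] [BorelSpace E] (μ : Measure E)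
    [μ.IsAddHaarMeasure] (vs : List E) (_ : vs.length = k) {L : Set E} (_ : IsCompact L)
    (_ : Convex ℝ L) {a b : ℝ} (_ : 0 ≤ a) (_ : 0 ≤ b),
    segDiff μ (vs.map fun v => b • v) (a • L) =
      a ^ (Module.finrank ℝ E - k) * b ^ k * segDiff μ vs L := by
  induction k with
  | zero =>
    intro E _ _ _ _ _ μ _ vs hvs L hL hLc a b ha hb
    obtain rfl := List.length_eq_zero_iff.1 hvs
    simp [segDiff, measureReal_def, Measure.addHaar_smul,
      abs_of_nonneg (pow_nonneg ha (Module.finrank ℝ E)),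
      ENNReal.toReal_ofReal (pow_nonneg ha (Module.finrank ℝ E))]
  | succ k ih =>
    intro E _ _ _ _ _ μ _ vs hvs L hL hLc a b ha hb
    obtain ⟨v, vs, rfl⟩ := List.exists_cons_of_length_eq_add_one hvs
    rcases eq_or_ne v 0 with rfl | hv
    · simp [segDiff]
    obtain ⟨ν, hν, h⟩ := exists_segDiff_cons μ hv
    have h1 := h vs L hL hLc 1 zero_le_one
    rw [one_smul] at h1
    have h2 : (ℝ ∙ v)ᗮ.orthogonalProjectionOnto '' (a • L) =
        a • ((ℝ ∙ v)ᗮ.orthogonalProjectionOnto '' L) := Set.image_smul_comm _ _ _ (by simp)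
    have h3 : Module.finrank ℝ E = Module.finrank ℝ (ℝ ∙ v)ᗮ + 1 := by
      rw [← Submodule.finrank_add_finrank_orthogonal (ℝ ∙ v), finrank_span_singleton hv, add_comm]
    have h4 := ih ν (vs.map (ℝ ∙ v)ᗮ.orthogonalProjectionOnto) (by simpa using hvs)
      (hL.image (ℝ ∙ v)ᗮ.orthogonalProjectionOnto.continuous)
      (hLc.linear_image (ℝ ∙ v)ᗮ.orthogonalProjectionOnto.toLinearMap) ha hb
    rw [List.map_cons, h _ _ (hL.smul a) (hLc.smul a) b hb, h1, h2, h3]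
    simp only [List.map_map, Function.comp_def, map_smul] at h4 ⊢
    erw [h4]
    simp only [Nat.add_sub_add_right]
    simp
    ring

theorem two_mul_segDiff_combImage_le {N : ℕ} {C : Set (Fin N → ℝ)} (hC : IsCompact C)
    (hCc : Convex ℝ C) (k : ℕ) : ∀ {E : Type u} [NormedAddCommGroup E] [InnerProductSpace ℝ E]
    [FiniteDimensional ℝ E] [MeasurableSpace E] [BorelSpace E] (μ : Measure E)
    [μ.IsAddHaarMeasure] (vs : List E) (_ : vs.length = k) (x : Fin N → E) (t : Fin N → ℝ)
    (θ : E), 2 * segDiff μ vs (combImage C x) ≤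
      segDiff μ vs (combImage C fun j => x j + t j • θ) +
      segDiff μ vs (combImage C fun j => x j - t j • θ) := by
  induction k with
  | zero =>
    intro E _ _ _ _ _ μ _ vs hvs x t θ
    obtain rfl := List.length_eq_zero_iff.1 hvs
    exact two_mul_measure_combImage_le μ hC hCc x t θ
  | succ k ih =>
    intro E _ _ _ _ _ μ _ vs hvs x t θ
    obtain ⟨v, vs, rfl⟩ := List.exists_cons_of_length_eq_add_one hvs
    rcases eq_or_ne v 0 with rfl | hv
    · simp [segDiff]
    obtain ⟨ν, hν, h⟩ := exists_segDiff_cons μ hv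
    have h1 (z : Fin N → E) : segDiff μ (v :: vs) (combImage C z) =
        segDiff ν (vs.map (ℝ ∙ v)ᗮ.orthogonalProjectionOnto)
          (combImage C fun j => (ℝ ∙ v)ᗮ.orthogonalProjectionOnto (z j)) := by
      have := h vs _ (isCompact_combImage hC z) (convex_combImage hCc z) 1 zero_le_one
      rw [one_smul, one_mul] at this
      rw [this]
      congr 1
      exact image_combImage (ℝ ∙ v)ᗮ.orthogonalProjectionOnto.toLinearMap C z
    simp only [h1, map_add, map_sub, map_smul]
    exact ih ν _ (by simpa using hvs) _ t _

end SegDiff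

section Counting

theorem nsmul_set_eq_smul {E : Type*} [AddCommGroup E] [Module ℝ E] {L : Set E}
    (hL : Convex ℝ L) (hn : L.Nonempty) (k : ℕ) : k • L = (k : ℝ) • L := by
  induction k with
  | zero => simp [Set.zero_smul_set hn]
  | succ k ih =>
    rw [succ_nsmul, ih, Nat.cast_succ, hL.add_smul (Nat.cast_nonneg k) zero_le_one, one_smul]

theorem sum_ite_set_eq {E ι : Type*} [AddCommGroup E] [Module ℝ E] (S : Finset ι) (p : ι → Prop)
    [DecidablePred p] {L Z : Set E} (hL : Convex ℝ L) (hLn : L.Nonempty) (hZ : Convex ℝ Z)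
    (hZn : Z.Nonempty) : ∑ j ∈ S, (if p j then L else Z) =
      ((S.filter p).card : ℝ) • L + ((S.filter fun j => ¬ p j).card : ℝ) • Z := by
  rw [Finset.sum_ite, Finset.sum_const, Finset.sum_const, nsmul_set_eq_smul hL hLn,
    nsmul_set_eq_smul hZ hZn]

theorem alternating_sum_powerset_card_pow {ι : Type*} (A : Finset ι) (k : ℕ) :
    ∑ T ∈ A.powerset, (-1 : ℝ) ^ (A.card - T.card) * (T.card : ℝ) ^ k =
      (fwdDiff (1 : ℝ))^[A.card] (fun x => x ^ k) 0 := by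
  rw [Finset.sum_powerset_apply_card (fun c => (-1 : ℝ) ^ (A.card - c) * (c : ℝ) ^ k),
    fwdDiff_iter_eq_sum_shift]
  refine Finset.sum_congr rfl fun c _ => ?_
  simp
  ring

theorem sum_finset_filter_mul_filter {ι : Type*} [Fintype ι] [DecidableEq ι] (p : ι → Prop)
    [DecidablePred p] (f g : Finset ι → ℝ) :
    ∑ S : Finset ι, f (S.filter p) * g (S.filter fun j => ¬ p j) =
      (∑ T ∈ (Finset.univ.filter p).powerset, f T) *
        ∑ T ∈ (Finset.univ.filter fun j => ¬ p j).powerset, g T := by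
  rw [Finset.sum_mul_sum, ← Finset.sum_product']
  refine Finset.sum_nbij' (fun S => (S.filter p, S.filter fun j => ¬ p j))
    (fun T => T.1 ∪ T.2) ?_ ?_ ?_ ?_ ?_
  · intro S _
    simp only [Finset.mem_product, Finset.mem_powerset]
    exact ⟨Finset.filter_subset_filter _ (Finset.subset_univ _),
      Finset.filter_subset_filter _ (Finset.subset_univ _)⟩
  · simp
  · intro S _
    exact Finset.filter_union_filter_not_eq _ _
  · rintro ⟨T, U⟩ h
    simp only [Finset.mem_product, Finset.mem_powerset, Finset.subset_iff, Finset.mem_filter,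
      Finset.mem_univ, true_and] at h
    ext j
    · have h1 := @h.1 j
      have h2 := @h.2 j
      simp only [Finset.mem_filter, Finset.mem_union]
      tauto
    · have h1 := @h.1 j
      have h2 := @h.2 j
      simp only [Finset.mem_filter, Finset.mem_union]
      tauto
  · simp

theorem alternating_sum_card_pow_mul_card_pow_nonneg {n i : ℕ} (hi : i < n) (k : ℕ) :
    0 ≤ ∑ S : Finset (Fin n), (-1 : ℝ) ^ (n - S.card) *
      (((S.filter fun j : Fin n => (j : ℕ) < n - i).card : ℝ) ^ (n - k) *
        ((S.filter fun j : Fin n => ¬ (j : ℕ) < n - i).card : ℝ) ^ k) := by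
  set p : Fin n → Prop := fun j => (j : ℕ) < n - i
  have hA : (Finset.univ.filter p).card = n - i := by
    rw [Fin.card_filter_val_lt]
    omega
  have hcard : (Finset.univ.filter p).card + (Finset.univ.filter fun j => ¬ p j).card = n := by
    rw [Finset.card_filter_add_card_filter_not]; simp
  have hB : (Finset.univ.filter fun j => ¬ p j).card = i := by omega
  have h : ∀ S : Finset (Fin n), (-1 : ℝ) ^ (n - S.card) *
      (((S.filter p).card : ℝ) ^ (n - k) * ((S.filter fun j => ¬ p j).card : ℝ) ^ k) =
      (fun T : Finset (Fin n) => (-1 : ℝ) ^ ((Finset.univ.filter p).card - T.card) *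
        (T.card : ℝ) ^ (n - k)) (S.filter p) *
      (fun T : Finset (Fin n) => (-1 : ℝ) ^ ((Finset.univ.filter fun j => ¬ p j).card - T.card) *
        (T.card : ℝ) ^ k) (S.filter fun j => ¬ p j) := by
    intro S
    have h1 : (S.filter p).card ≤ (Finset.univ.filter p).card :=
      Finset.card_le_card (Finset.filter_subset_filter _ (Finset.subset_univ _))
    have h2 : (S.filter fun j => ¬ p j).card ≤ (Finset.univ.filter fun j => ¬ p j).card :=
      Finset.card_le_card (Finset.filter_subset_filter _ (Finset.subset_univ _))
    have h3 : (S.filter p).card + (S.filter fun j => ¬ p j).card = S.card :=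
      Finset.card_filter_add_card_filter_not p
    have h4 : n - S.card = ((Finset.univ.filter p).card - (S.filter p).card) +
      ((Finset.univ.filter fun j => ¬ p j).card - (S.filter fun j => ¬ p j).card) := by omega
    rw [h4, pow_add]
    ring
  rw [Finset.sum_congr rfl fun S _ => h S, sum_finset_filter_mul_filter p
      (fun T => (-1 : ℝ) ^ ((Finset.univ.filter p).card - T.card) * (T.card : ℝ) ^ (n - k))
      (fun T => (-1 : ℝ) ^ ((Finset.univ.filter fun j => ¬ p j).card - T.card) *
        (T.card : ℝ) ^ k),
    alternating_sum_powerset_card_pow, alternating_sum_powerset_card_pow, hA, hB]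
  rcases lt_trichotomy k i with hk | rfl | hk
  · rw [fwdDiff_iter_pow_eq_zero_of_lt hk]; simp
  · rw [fwdDiff_iter_eq_factorial, fwdDiff_iter_eq_factorial]
    simp only [Pi.natCast_apply]
    positivity
  · rw [fwdDiff_iter_pow_eq_zero_of_lt (by omega : n - k < n - i)]; simp

end Counting

section ZonotopeQuermass

theorem smul_zonotope {E : Type*} [NormedAddCommGroup E] [InnerProductSpace ℝ E] (b : ℝ)
    (vs : List E) : b • zonotope vs = zonotope (vs.map fun v => b • v) := by
  induction vs with
  | nil => simp [zonotope]
  | cons v vs ih =>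
    have h : b • segment ℝ 0 v = segment ℝ 0 (b • v) := by
      simpa using image_segment ℝ (DistribSMul.toLinearMap ℝ E b).toAffineMap 0 v
    simp only [zonotope, List.map_cons, List.sum_cons, smul_add, h] at ih ⊢
    rw [ih]

theorem convex_zonotope {E : Type*} [NormedAddCommGroup E] [InnerProductSpace ℝ E]
    (vs : List E) : Convex ℝ (zonotope vs) := by
  induction vs with
  | nil => exact convex_singleton (0 : E)
  | cons v vs ih =>
    rw [zonotope, List.map_cons, List.sum_cons]
    exact (convex_segment 0 v).add ih

theorem isCompact_zonotope {E : Type*} [NormedAddCommGroup E] [InnerProductSpace ℝ E]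
    (vs : List E) : IsCompact (zonotope vs) := by
  induction vs with
  | nil => simp [zonotope]
  | cons v vs ih => simpa [zonotope] using (isCompact_segment 0 v).add ih

theorem zonotope_nonempty {E : Type*} [NormedAddCommGroup E] [InnerProductSpace ℝ E]
    (vs : List E) : (zonotope vs).Nonempty := by
  induction vs with
  | nil => simp [zonotope]
  | cons v vs ih =>
    simpa [zonotope] using (show (segment ℝ 0 v).Nonempty from ⟨0, left_mem_segment ℝ 0 v⟩).add ih

theorem sum_mul_list_sum {ι α : Type*} (s : Finset ι) (l : List α) (c : ι → ℝ)
    (f : ι → α → ℝ) : ∑ S ∈ s, c S * (l.map (f S)).sum =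
      (l.map fun w => ∑ S ∈ s, c S * f S w).sum := by
  induction l with
  | nil => simp
  | cons a l ih => simp [mul_add, Finset.sum_add_distrib, ih]

theorem mixedVol_zonotope {n i : ℕ} {L : Set (EuclideanSpace ℝ (Fin n))} (hL : IsCompact L)
    (hLc : Convex ℝ L) (hLn : L.Nonempty) (vs : List (EuclideanSpace ℝ (Fin n))) :
    mixedVol n (fun j => if (j : ℕ) < n - i then L else zonotope vs) =
      (n.factorial : ℝ)⁻¹ * (vs.sublists'.map fun ws =>
        (∑ S : Finset (Fin n), (-1 : ℝ) ^ (n - S.card) *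
      (((S.filter fun j : Fin n => (j : ℕ) < n - i).card : ℝ) ^ (n - ws.length) *
        ((S.filter fun j : Fin n => ¬ (j : ℕ) < n - i).card : ℝ) ^ ws.length)) *
          segDiff volume ws L).sum := by
  rw [mixedVol]
  congr 1
  simp_rw [Finset.sum_mul, mul_assoc, ← sum_mul_list_sum]
  refine Finset.sum_congr rfl fun S _ => ?_
  congr 1
  rw [sum_ite_set_eq S _ hLc hLn (convex_zonotope vs) (zonotope_nonempty vs), smul_zonotope,
    ← measureReal_def, measureReal_add_zonotope, List.sublists'_map, List.map_map]
  congr 1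
  refine List.map_congr_left fun ws _ => ?_
  rw [Function.comp_apply, segDiff_smul ws.length volume ws rfl hL hLc (Nat.cast_nonneg _)
    (Nat.cast_nonneg _), finrank_euclideanSpace_fin]
  ring

theorem two_mul_mixedVol_zonotope_le {n i N : ℕ} (hi : i < n) {C : Set (Fin N → ℝ)}
    (hC : IsCompact C) (hCc : Convex ℝ C) (hCn : C.Nonempty)
    (vs : List (EuclideanSpace ℝ (Fin n))) (x : Fin N → EuclideanSpace ℝ (Fin n))
    (t : Fin N → ℝ) (θ : EuclideanSpace ℝ (Fin n)) :
    2 * mixedVol n (fun j => if (j : ℕ) < n - i then combImage C x else zonotope vs) ≤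
      mixedVol n (fun j => if (j : ℕ) < n - i then combImage C (fun j => x j + t j • θ)
        else zonotope vs) +
      mixedVol n (fun j => if (j : ℕ) < n - i then combImage C (fun j => x j - t j • θ)
        else zonotope vs) := by
  rw [mixedVol_zonotope (isCompact_combImage hC _) (convex_combImage hCc _) (hCn.image _),
    mixedVol_zonotope (isCompact_combImage hC _) (convex_combImage hCc _) (hCn.image _),
    mixedVol_zonotope (isCompact_combImage hC _) (convex_combImage hCc _) (hCn.image _),
    ← mul_add, mul_left_comm, ← List.sum_map_add, ← List.sum_map_mul_left]
  refine mul_le_mul_of_nonneg_left (List.sum_le_sum fun ws _ => ?_) (by positivity)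
  rw [mul_left_comm, ← mul_add]
  exact mul_le_mul_of_nonneg_left
    (two_mul_segDiff_combImage_le hC hCc ws.length volume ws rfl x t θ)
    (alternating_sum_card_pow_mul_card_pow_nonneg hi _)

end ZonotopeQuermass

section BallApproximation

variable {E : Type*} [NormedAddCommGroup E] [InnerProductSpace ℝ E]

theorem inner_le_of_mem_zonotope (x : E) (vs : List E) :
    ∀ z ∈ zonotope vs, inner ℝ x z ≤ (vs.map fun v => max (inner ℝ x v) 0).sum := by
  induction vs with
  | nil => simp [zonotope]
  | cons v vs ih =>
    rw [zonotope, List.map_cons, List.sum_cons]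
    rintro _ ⟨y, hy, z, hz, rfl⟩
    have h1 := ih z hz
    rw [← one_smul ℝ v] at hy
    obtain ⟨s, ⟨h0, h1⟩, rfl⟩ := (mem_segment_zero_smul zero_le_one).1 hy
    simp only [List.map_cons, List.sum_cons, inner_add_right, inner_smul_right]
    refine add_le_add ?_ (ih z hz)
    rcases le_total (inner ℝ x v) 0 with h | h
    · exact le_max_of_le_right (mul_nonpos_of_nonneg_of_nonpos h0 h)
    · exact le_max_of_le_left (mul_le_of_le_one_left h h1)

theorem exists_mem_zonotope_inner_eq (x : E) (vs : List E) :
    ∃ z ∈ zonotope vs, inner ℝ x z = (vs.map fun v => max (inner ℝ x v) 0).sum := by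
  induction vs with
  | nil => exact ⟨0, by simp [zonotope], by simp⟩
  | cons v vs ih =>
    obtain ⟨z, hz, h⟩ := ih
    rw [zonotope, List.map_cons, List.sum_cons]
    simp only [List.map_cons, List.sum_cons]
    rcases le_total (inner ℝ x v) 0 with hv | hv
    · exact ⟨0 + z, Set.add_mem_add (left_mem_segment ℝ 0 v) hz, by simp [h, hv]⟩
    · exact ⟨v + z, Set.add_mem_add (right_mem_segment ℝ 0 v) hz, by
        simp [h, hv, inner_add_right]⟩

theorem zonotope_subset_closedBall {vs : List E} {r : ℝ} (hr : 0 ≤ r)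
    (h : ∀ x : E, ‖x‖ = 1 → (vs.map fun v => max (inner ℝ x v) 0).sum ≤ r) :
    zonotope vs ⊆ Metric.closedBall 0 r := by
  intro z hz
  rw [mem_closedBall_zero_iff]
  rcases eq_or_ne z 0 with rfl | hz0
  · simpa using hr
  have h1 := (inner_le_of_mem_zonotope (‖z‖⁻¹ • z) vs z hz).trans
    (h _ (norm_smul_inv_norm hz0))
  rwa [real_inner_smul_left, real_inner_self_eq_norm_sq, sq, inv_mul_cancel_left₀
    (norm_ne_zero_iff.2 hz0)] at h1

theorem closedBall_subset_zonotope [FiniteDimensional ℝ E] {vs : List E} {r : ℝ}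
    (h : ∀ x : E, ‖x‖ = 1 → r ≤ (vs.map fun v => max (inner ℝ x v) 0).sum) :
    Metric.closedBall 0 r ⊆ zonotope vs := by
  intro y hy
  rw [mem_closedBall_zero_iff] at hy
  by_contra hn
  obtain ⟨f, u, hf, hfy⟩ : ∃ (f : StrongDual ℝ E) (u : ℝ), (∀ a ∈ zonotope vs, f a < u) ∧ u < f y :=
    geometric_hahn_banach_closed_point (convex_zonotope vs) (isCompact_zonotope vs).isClosed hn
  obtain ⟨w, rfl⟩ := (InnerProductSpace.toDual ℝ E).surjective f
  simp only [InnerProductSpace.toDual_apply_apply] at hf hfy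
  have hw : w ≠ 0 := by
    rintro rfl
    obtain ⟨z, hz⟩ := zonotope_nonempty vs
    have := (hf z hz).trans hfy
    simp at this
  obtain ⟨z, hz, hz'⟩ := exists_mem_zonotope_inner_eq (‖w‖⁻¹ • w) vs
  have h1 := h (‖w‖⁻¹ • w) (norm_smul_inv_norm (𝕜 := ℝ) hw)
  have h2 : inner ℝ (‖w‖⁻¹ • w) z < inner ℝ (‖w‖⁻¹ • w) y := by
    simp only [real_inner_smul_left]
    have : 0 < ‖w‖⁻¹ := inv_pos.2 (norm_pos_iff.2 hw)
    exact mul_lt_mul_of_pos_left ((hf z hz).trans hfy) this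
  have h3 := real_inner_le_norm (‖w‖⁻¹ • w) y
  have h4 : ‖‖w‖⁻¹ • w‖ = 1 := norm_smul_inv_norm hw
  rw [h4, one_mul] at h3
  linarith

theorem smul_closedBall_zero_eq {r : ℝ} (hr : 0 ≤ r) :
    Metric.closedBall (0 : E) r = r • Metric.closedBall (0 : E) 1 := by
  rw [smul_closedBall _ _ zero_le_one]
  simp [abs_of_nonneg hr]

variable [FiniteDimensional ℝ E] [MeasurableSpace E] [BorelSpace E]

theorem setIntegral_max_inner_eq {x y : E} (h : ‖x‖ = ‖y‖) :
    ∫ u in Metric.closedBall (0 : E) 1, max (inner ℝ x u) 0 =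
      ∫ u in Metric.closedBall (0 : E) 1, max (inner ℝ y u) 0 := by
  let ρ : E ≃ₗᵢ[ℝ] E := (ℝ ∙ (x - y))ᗮ.reflection
  have hρ : ρ x = y := Submodule.reflection_sub h
  have h1 := ρ.measurePreserving.setIntegral_preimage_emb
    ρ.toHomeomorph.measurableEmbedding (fun u => max (inner ℝ y u) 0) (Metric.closedBall 0 1)
  rw [← h1]
  have h2 : ρ ⁻¹' Metric.closedBall 0 1 = Metric.closedBall 0 1 := by
    ext u; simp
  rw [h2, ← hρ]
  simp

theorem setIntegral_max_inner_pos {x : E} (h : x ≠ 0) :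
    0 < ∫ u in Metric.closedBall (0 : E) 1, max (inner ℝ x u) 0 := by
  have hcont : Continuous fun u : E => max (inner ℝ x u) 0 := by fun_prop
  have hnn : 0 ≤ᵐ[volume.restrict (Metric.closedBall (0 : E) 1)]
      fun u : E => max (inner ℝ x u) 0 := Filter.Eventually.of_forall fun u => le_max_right _ _
  rw [setIntegral_pos_iff_support_of_nonneg_ae hnn
    (hcont.continuousOn.integrableOn_compact (isCompact_closedBall 0 1))]
  have ho : IsOpen ({u : E | 0 < inner ℝ x u} ∩ Metric.ball 0 1) :=
    (isOpen_lt continuous_const (by fun_prop)).inter Metric.isOpen_ball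
  have hn : ({u : E | 0 < inner ℝ x u} ∩ Metric.ball 0 1).Nonempty := by
    have hx := norm_pos_iff.2 h
    refine ⟨(2 * ‖x‖)⁻¹ • x, ?_, ?_⟩
    · simp only [Set.mem_ofPred_eq, inner_smul_right, real_inner_self_eq_norm_sq]
      positivity
    · rw [mem_ball_zero_iff, norm_smul, Real.norm_of_nonneg (by positivity), mul_inv, mul_assoc,
        inv_mul_cancel₀ hx.ne']
      norm_num
  refine (ho.measure_pos volume hn).trans_le (measure_mono ?_)
  rintro u ⟨hu, hu'⟩
  exact ⟨by simpa [Function.mem_support] using hu, Metric.ball_subset_closedBall hu'⟩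

theorem exists_zonotope_support_approx [Nontrivial E] {ε : ℝ} (hε : 0 < ε) :
    ∃ vs : List E, ∀ x : E, ‖x‖ = 1 →
      |(vs.map fun v => max (inner ℝ x v) 0).sum - 1| ≤ ε := by
  obtain ⟨e, he⟩ := exists_norm_eq E zero_le_one
  set B := Metric.closedBall (0 : E) 1
  set κ : ℝ := ⨍ u in B, max (inner ℝ e u) 0 with hκ
  have hB0 : volume B ≠ 0 := (Metric.measure_closedBall_pos volume 0 one_pos).ne'
  have hBt : volume B ≠ ⊤ := measure_closedBall_lt_top.ne
  have hκ0 : 0 < κ := by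
    rw [hκ, setAverage_eq]
    exact smul_pos (inv_pos.2 (ENNReal.toReal_pos hB0 hBt))
      (setIntegral_max_inner_pos (by rintro rfl; simp at he))
  let Φ : C(E × Metric.sphere (0 : E) 1, ℝ) :=
    ⟨fun p => max (inner ℝ (p.2 : E) p.1) 0, by fun_prop⟩
  let φ : C(E, C(Metric.sphere (0 : E) 1, ℝ)) := Φ.curry
  have hφ (u : E) (x : Metric.sphere (0 : E) 1) : φ u x = max (inner ℝ (x : E) u) 0 := rfl
  let s : Set C(Metric.sphere (0 : E) 1, ℝ) :=
    {f | ∃ vs : List E, ∀ x, f x = (vs.map fun v => max (inner ℝ (x : E) v) 0).sum}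
  have hscale (a : ℝ) (ha : 0 ≤ a) (x : E) (vs : List E) :
      ((vs.map fun v => a • v).map fun v => max (inner ℝ x v) 0).sum =
        a * (vs.map fun v => max (inner ℝ x v) 0).sum := by
    rw [List.map_map, ← List.sum_map_mul_left]
    congr 1
    refine List.map_congr_left fun v _ => ?_
    simp [inner_smul_right, mul_max_of_nonneg _ _ ha]
  have hs : Convex ℝ s := by
    rintro f ⟨vs, hf⟩ g ⟨ws, hg⟩ a b ha hb -
    refine ⟨vs.map (fun v => a • v) ++ ws.map fun v => b • v, fun x => ?_⟩
    rw [List.map_append, List.sum_append, hscale a ha, hscale b hb, ← hf, ← hg]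
    simp
  have hfi : IntegrableOn φ B volume :=
    φ.continuous.continuousOn.integrableOn_compact (isCompact_closedBall 0 1)
  have hmem : (⨍ u in B, φ u) ∈ closure s :=
    hs.closure.set_average_mem isClosed_closure hB0 hBt
      (Filter.Eventually.of_forall fun u => subset_closure ⟨[u], fun x => by simp [hφ]⟩) hfi
  have hval (x : Metric.sphere (0 : E) 1) : (⨍ u in B, φ u) x = κ := by
    rw [hκ, setAverage_eq, setAverage_eq, ContinuousMap.smul_apply,
      ContinuousMap.integral_apply hfi]
    congr 1
    exact setIntegral_max_inner_eq (x := (x : E)) (y := e) (by rw [he]; simp)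
  obtain ⟨f, ⟨vs, hf⟩, hd⟩ := Metric.mem_closure_iff.1 hmem (ε * κ) (by positivity)
  refine ⟨vs.map fun v => κ⁻¹ • v, fun x hx => ?_⟩
  rw [hscale _ (inv_nonneg.2 hκ0.le)]
  have h1 := (ContinuousMap.dist_apply_le_dist (f := ⨍ u in B, φ u) (g := f)
    ⟨x, by simpa using hx⟩).trans hd.le
  rw [hval, hf, dist_comm, Real.dist_eq] at h1
  have h2 : κ⁻¹ * (vs.map fun v => max (inner ℝ x v) 0).sum - 1 =
      κ⁻¹ * ((vs.map fun v => max (inner ℝ x v) 0).sum - κ) := by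
    rw [mul_sub, inv_mul_cancel₀ hκ0.ne']
  rw [h2, abs_mul, abs_of_pos (inv_pos.2 hκ0), inv_mul_le_iff₀ hκ0, mul_comm]
  exact h1

theorem exists_zonotope_between_closedBall [Nontrivial E] {ε : ℝ} (hε : 0 < ε) :
    ∃ vs : List E, Metric.closedBall 0 (1 - ε) ⊆ zonotope vs ∧
      zonotope vs ⊆ Metric.closedBall 0 (1 + ε) := by
  obtain ⟨vs, h⟩ := exists_zonotope_support_approx (E := E) hε
  refine ⟨vs, closedBall_subset_zonotope fun x hx => ?_,
    zonotope_subset_closedBall (by positivity) fun x hx => ?_⟩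
  · linarith [(abs_le.1 (h x hx)).1]
  · linarith [(abs_le.1 (h x hx)).2]

theorem measureReal_add_smul_le_of_subset (μ : Measure E) [μ.IsAddHaarMeasure] {A Z : Set E}
    (hA : IsCompact A) (hAc : Convex ℝ A) (hAn : A.Nonempty) {b ε : ℝ} (hε : 0 ≤ ε)
    (h : Z ⊆ Metric.closedBall 0 (1 + ε)) :
    μ.real (A + b • Z) ≤
      (1 + ε) ^ Module.finrank ℝ E * μ.real (A + b • Metric.closedBall (0 : E) 1) := by
  obtain ⟨p, hp⟩ := hAn
  have hB : IsCompact (A + b • Metric.closedBall (0 : E) 1) :=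
    hA.add ((isCompact_closedBall 0 1).smul b)
  have hsub : (ε • p) +ᵥ (A + b • Z) ⊆ (1 + ε) • (A + b • Metric.closedBall (0 : E) 1) := by
    rw [smul_add, smul_comm (1 + ε) b, ← smul_closedBall_zero_eq (by positivity),
      hAc.add_smul zero_le_one hε, one_smul]
    rintro _ ⟨_, ⟨a, ha, z, ⟨w, hw, rfl⟩, rfl⟩, rfl⟩
    exact ⟨a + ε • p, ⟨a, ha, _, ⟨p, hp, rfl⟩, rfl⟩, b • w, ⟨w, h hw, rfl⟩, by
      simp only [vadd_eq_add]; abel⟩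
  have h1 := measureReal_mono (μ := μ) hsub (hB.smul _).measure_lt_top.ne
  rwa [measureReal_def, measure_vadd, ← measureReal_def, measureReal_def μ (_ • _),
    Measure.addHaar_smul_of_nonneg μ (by positivity), ENNReal.toReal_mul,
    ENNReal.toReal_ofReal (by positivity), ← measureReal_def] at h1

theorem le_measureReal_add_smul_of_subset (μ : Measure E) [μ.IsAddHaarMeasure] {A Z : Set E}
    (hA : IsCompact A) (hAc : Convex ℝ A) (hAn : A.Nonempty) (hZ : IsCompact Z) {b ε : ℝ}
    (hε : 0 ≤ ε) (hε1 : ε ≤ 1) (h : Metric.closedBall 0 (1 - ε) ⊆ Z) :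
    (1 - ε) ^ Module.finrank ℝ E * μ.real (A + b • Metric.closedBall (0 : E) 1) ≤
      μ.real (A + b • Z) := by
  obtain ⟨p, hp⟩ := hAn
  have hε1' : 0 ≤ 1 - ε := by linarith
  have hsub : (ε • p) +ᵥ (1 - ε) • (A + b • Metric.closedBall (0 : E) 1) ⊆ A + b • Z := by
    rw [smul_add, smul_comm (1 - ε) b, ← smul_closedBall_zero_eq hε1']
    rintro _ ⟨_, ⟨_, ⟨a, ha, rfl⟩, z, ⟨w, hw, rfl⟩, rfl⟩, rfl⟩
    exact ⟨(1 - ε) • a + ε • p, hAc ha hp hε1' hε (by ring), b • w, ⟨w, h hw, rfl⟩, by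
      simp only [vadd_eq_add]; abel⟩
  have h1 := measureReal_mono (μ := μ) hsub (hA.add (hZ.smul b)).measure_lt_top.ne
  rwa [measureReal_def, measure_vadd, ← measureReal_def, measureReal_def μ (_ • _),
    Measure.addHaar_smul_of_nonneg μ (by positivity), ENNReal.toReal_mul,
    ENNReal.toReal_ofReal (by positivity), ← measureReal_def] at h1

theorem tendsto_measureReal_add_smul (μ : Measure E) [μ.IsAddHaarMeasure] {A : Set E}
    (hA : IsCompact A) (hAc : Convex ℝ A) (hAn : A.Nonempty) {b : ℝ} {Z : ℕ → Set E}
    (hZ : ∀ k, IsCompact (Z k))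
    (h : ∀ k : ℕ, Metric.closedBall 0 (1 - 1 / ((k : ℝ) + 1)) ⊆ Z k)
    (h' : ∀ k : ℕ, Z k ⊆ Metric.closedBall 0 (1 + 1 / ((k : ℝ) + 1))) :
    Filter.Tendsto (fun k => μ.real (A + b • Z k)) Filter.atTop
      (nhds (μ.real (A + b • Metric.closedBall (0 : E) 1))) := by
  have hε (k : ℕ) : (0 : ℝ) < 1 / ((k : ℝ) + 1) := by positivity
  have ht : Filter.Tendsto (fun k : ℕ => 1 / ((k : ℝ) + 1)) Filter.atTop (nhds 0) :=
    tendsto_one_div_add_atTop_nhds_zero_nat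
  set v := μ.real (A + b • Metric.closedBall (0 : E) 1) with hv
  have h1 := ((ht.const_sub 1).pow (Module.finrank ℝ E)).mul_const v
  have h2 := ((ht.const_add 1).pow (Module.finrank ℝ E)).mul_const v
  rw [sub_zero, one_pow, one_mul] at h1
  rw [add_zero, one_pow, one_mul] at h2
  refine tendsto_of_tendsto_of_tendsto_of_le_of_le h1 h2 (fun k => ?_) (fun k => ?_)
  · exact le_measureReal_add_smul_of_subset μ hA hAc hAn (hZ k) (hε k).le
      ((div_le_one (by positivity)).2 (by linarith [k.cast_nonneg (α := ℝ)])) (h k)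
  · exact measureReal_add_smul_le_of_subset μ hA hAc hAn (hε k).le (h' k)

end BallApproximation

section QuermassMidpoint

theorem exists_tendsto_mixedVol_zonotope {n : ℕ} (hn : 0 < n) (i : ℕ) :
    ∃ vs : ℕ → List (EuclideanSpace ℝ (Fin n)), ∀ L : Set (EuclideanSpace ℝ (Fin n)),
      IsCompact L → Convex ℝ L → L.Nonempty → Filter.Tendsto
        (fun k => mixedVol n fun j => if (j : ℕ) < n - i then L else zonotope (vs k))
        Filter.atTop (nhds (quermass n i L)) := by
  have : Nonempty (Fin n) := ⟨⟨0, hn⟩⟩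
  have hε (k : ℕ) : (0 : ℝ) < 1 / ((k : ℝ) + 1) := by positivity
  choose vs hvs hvs' using fun k : ℕ =>
    exists_zonotope_between_closedBall (E := EuclideanSpace ℝ (Fin n)) (hε k)
  refine ⟨vs, fun L hL hLc hLn => ?_⟩
  rw [quermass]
  simp only [mixedVol]
  refine Filter.Tendsto.const_mul _ (tendsto_finsetSum _ fun S _ => Filter.Tendsto.const_mul _ ?_)
  simp only [sum_ite_set_eq S _ hLc hLn (convex_zonotope _) (zonotope_nonempty _)]
  rw [sum_ite_set_eq S _ hLc hLn (convex_closedBall _ _)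
    (Metric.nonempty_closedBall.2 zero_le_one)]
  simp only [← measureReal_def]
  exact tendsto_measureReal_add_smul volume (hL.smul _) (hLc.smul _) hLn.smul_set
    (fun k => isCompact_zonotope (vs k)) hvs hvs'

theorem two_mul_quermass_combImage_le {n i N : ℕ} (hi : i < n) {C : Set (Fin N → ℝ)}
    (hC : IsCompact C) (hCc : Convex ℝ C) (hCn : C.Nonempty)
    (x : Fin N → EuclideanSpace ℝ (Fin n)) (t : Fin N → ℝ) (θ : EuclideanSpace ℝ (Fin n)) :
    2 * quermass n i (combImage C x) ≤ quermass n i (combImage C fun j => x j + t j • θ) +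
      quermass n i (combImage C fun j => x j - t j • θ) := by
  obtain ⟨vs, h⟩ := exists_tendsto_mixedVol_zonotope (n := n) (by omega) i
  have h' (z : Fin N → EuclideanSpace ℝ (Fin n)) :=
    h _ (isCompact_combImage hC z) (convex_combImage hCc z) (hCn.image _)
  exact le_of_tendsto_of_tendsto' ((h' _).const_mul 2) ((h' _).add (h' _))
    fun k => two_mul_mixedVol_zonotope_le hi hC hCc hCn (vs k) x t θ

end QuermassMidpoint

section QuermassRegularity

variable {n i N : ℕ} {C : Set (Fin N → ℝ)}

theorem quermass_image_linearIsometryEquiv (n i : ℕ)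
    (R : EuclideanSpace ℝ (Fin n) ≃ₗᵢ[ℝ] EuclideanSpace ℝ (Fin n))
    (L : Set (EuclideanSpace ℝ (Fin n))) : quermass n i (R '' L) = quermass n i L := by
  have hvol (s : Set (EuclideanSpace ℝ (Fin n))) : volume (R '' s) = volume s := by
    rw [R.image_eq_preimage_symm]
    exact R.symm.measurePreserving.measure_preimage_emb
      R.symm.toHomeomorph.measurableEmbedding s
  rw [quermass, quermass, mixedVol, mixedVol]
  congr 1
  refine Finset.sum_congr rfl fun S _ => ?_
  congr 2
  refine Eq.trans ?_ (hvol _)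
  rw [Set.image_finsetSum]
  congr 1
  refine Finset.sum_congr rfl fun j _ => ?_
  split_ifs
  · rfl
  · simp

theorem quermass_combImage_linearIsometryEquiv (i : ℕ) (C : Set (Fin N → ℝ))
    (R : EuclideanSpace ℝ (Fin n) ≃ₗᵢ[ℝ] EuclideanSpace ℝ (Fin n))
    (x : Fin N → EuclideanSpace ℝ (Fin n)) :
    quermass n i (combImage C fun j => R (x j)) = quermass n i (combImage C x) := by
  rw [← quermass_image_linearIsometryEquiv n i R (combImage C x)]
  congr 1
  exact (image_combImage R.toLinearEquiv.toLinearMap C x).symm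

theorem smul_combImage_add_smul_eq {E : Type*} [AddCommGroup E] [Module ℝ E] (a b : ℝ)
    (C : Set (Fin N → ℝ)) (B : Set E) (x : Fin N → E) :
    a • combImage C x + b • B =
      (fun p : (Fin N → ℝ) × E => a • ∑ j, p.1 j • x j + b • p.2) '' C ×ˢ B := by
  ext z
  constructor
  · rintro ⟨_, ⟨_, ⟨c, hc, rfl⟩, rfl⟩, _, ⟨w, hw, rfl⟩, rfl⟩
    exact ⟨(c, w), ⟨hc, hw⟩, rfl⟩
  · rintro ⟨⟨c, w⟩, ⟨hc, hw⟩, rfl⟩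
    exact ⟨_, ⟨_, ⟨c, hc, rfl⟩, rfl⟩, _, ⟨w, hw, rfl⟩, rfl⟩

theorem isClosed_setOf_mem_image {α β γ : Type*} [TopologicalSpace α] [TopologicalSpace β]
    [TopologicalSpace γ] [T2Space γ] {g : α → β → γ} (hg : Continuous fun p : α × β => g p.1 p.2)
    {D : Set β} (hD : IsCompact D) : IsClosed {p : α × γ | p.2 ∈ g p.1 '' D} := by
  have : CompactSpace D := isCompact_iff_compactSpace.1 hD
  have hc : IsClosed {q : (α × γ) × D | g q.1.1 q.2 = q.1.2} :=
    isClosed_eq (hg.comp (by fun_prop : Continuous fun q : (α × γ) × D => (q.1.1, (q.2 : β))))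
      (by fun_prop)
  convert isClosedMap_fst_of_compactSpace _ hc using 1
  ext ⟨x, z⟩
  simp

theorem quermass_combImage_eq_sum (i : ℕ) (hCc : Convex ℝ C) (hCn : C.Nonempty)
    (x : Fin N → EuclideanSpace ℝ (Fin n)) : quermass n i (combImage C x) =
      ((n.factorial : ℝ))⁻¹ * ∑ S : Finset (Fin n), (-1 : ℝ) ^ (n - S.card) *
        (volume ((fun p : (Fin N → ℝ) × EuclideanSpace ℝ (Fin n) =>
          ((S.filter fun j : Fin n => (j : ℕ) < n - i).card : ℝ) • ∑ j, p.1 j • x j +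
            ((S.filter fun j : Fin n => ¬ (j : ℕ) < n - i).card : ℝ) • p.2) ''
          C ×ˢ Metric.closedBall 0 1)).toReal := by
  rw [quermass, mixedVol]
  congr 1
  refine Finset.sum_congr rfl fun S _ => ?_
  rw [sum_ite_set_eq S _ (convex_combImage hCc x) (hCn.image _) (convex_closedBall _ _)
    (Metric.nonempty_closedBall.2 zero_le_one), smul_combImage_add_smul_eq]

theorem measurable_quermass_combImage (n i : ℕ) (hC : IsCompact C) (hCc : Convex ℝ C)
    (hCn : C.Nonempty) :
    Measurable fun x : Fin N → EuclideanSpace ℝ (Fin n) => quermass n i (combImage C x) := by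
  simp only [quermass_combImage_eq_sum i hCc hCn]
  refine Measurable.const_mul (Finset.measurable_sum _ fun S _ => Measurable.const_mul
    (Measurable.ennreal_toReal ?_) _) _
  exact measurable_measure_prodMk_left (isClosed_setOf_mem_image
    (g := fun (x : Fin N → EuclideanSpace ℝ (Fin n))
        (p : (Fin N → ℝ) × EuclideanSpace ℝ (Fin n)) =>
      ((S.filter fun j : Fin n => (j : ℕ) < n - i).card : ℝ) • ∑ j, p.1 j • x j +
        ((S.filter fun j : Fin n => ¬ (j : ℕ) < n - i).card : ℝ) • p.2)
    (by fun_prop) (hC.prod (isCompact_closedBall 0 1))).measurableSet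

theorem exists_abs_quermass_combImage_le (n i : ℕ) (hC : IsCompact C) (hCc : Convex ℝ C)
    (hCn : C.Nonempty) {X : Set (Fin N → EuclideanSpace ℝ (Fin n))} (hX : IsCompact X) :
    ∃ M, ∀ x ∈ X, |quermass n i (combImage C x)| ≤ M := by
  let g (S : Finset (Fin n)) (x : Fin N → EuclideanSpace ℝ (Fin n))
      (p : (Fin N → ℝ) × EuclideanSpace ℝ (Fin n)) : EuclideanSpace ℝ (Fin n) :=
    ((S.filter fun j : Fin n => (j : ℕ) < n - i).card : ℝ) • ∑ j, p.1 j • x j +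
      ((S.filter fun j : Fin n => ¬ (j : ℕ) < n - i).card : ℝ) • p.2
  let W (S : Finset (Fin n)) : Set (EuclideanSpace ℝ (Fin n)) :=
    (fun q : (Fin N → EuclideanSpace ℝ (Fin n)) × (Fin N → ℝ) × EuclideanSpace ℝ (Fin n) =>
      g S q.1 q.2) '' X ×ˢ C ×ˢ Metric.closedBall 0 1
  have hW (S) : IsCompact (W S) :=
    (hX.prod (hC.prod (isCompact_closedBall 0 1))).image (by fun_prop)
  refine ⟨((n.factorial : ℝ))⁻¹ * ∑ S : Finset (Fin n), (volume (W S)).toReal, fun x hx => ?_⟩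
  rw [quermass_combImage_eq_sum i hCc hCn, abs_mul, abs_of_nonneg (by positivity)]
  refine mul_le_mul_of_nonneg_left ((Finset.abs_sum_le_sum_abs _ _).trans
    (Finset.sum_le_sum fun S _ => ?_)) (by positivity)
  rw [abs_mul, abs_pow, abs_neg, abs_one, one_pow, one_mul, abs_of_nonneg ENNReal.toReal_nonneg]
  refine ENNReal.toReal_mono (hW S).measure_lt_top.ne (measure_mono ?_)
  rintro _ ⟨p, hp, rfl⟩
  exact ⟨(x, p), ⟨hx, hp⟩, rfl⟩

end QuermassRegularity

section Steiner

variable {E : Type*} [NormedAddCommGroup E] [InnerProductSpace ℝ E]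

/-- The Steiner symmetral of a set with respect to the hyperplane orthogonal to `θ`: over each
point of the hyperplane, it consists of the half differences of points of the line fiber. -/
noncomputable def steiner (θ : E) (L : Set E) : Set E :=
  (fun p : E × E => (2⁻¹ : ℝ) • (p.1 + (ℝ ∙ θ)ᗮ.reflection p.2)) '' {p ∈ L ×ˢ L |
    (ℝ ∙ θ)ᗮ.orthogonalProjectionOnto p.1 = (ℝ ∙ θ)ᗮ.orthogonalProjectionOnto p.2}

theorem reflection_smul_add (θ : E) (r : ℝ) (y : (ℝ ∙ θ)ᗮ) :
    (ℝ ∙ θ)ᗮ.reflection (r • θ + (y : E)) = (-r) • θ + (y : E) := by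
  rw [map_add, map_smul, Submodule.reflection_orthogonalComplement_singleton_eq_neg,
    Submodule.reflection_mem_subspace_eq_self y.2, smul_neg, neg_smul]

theorem mem_lineFiber_steiner {θ : E} (hθ : θ ≠ 0) {y : (ℝ ∙ θ)ᗮ} {L : Set E} {r : ℝ} :
    r ∈ lineFiber θ y (steiner θ L) ↔
      ∃ a ∈ lineFiber θ y L, ∃ b ∈ lineFiber θ y L, r = (a - b) / 2 := by
  rw [mem_lineFiber]
  constructor
  · rintro ⟨⟨u, v⟩, ⟨⟨hu, hv⟩, h⟩, huv⟩
    obtain ⟨a, y₁, rfl⟩ := exists_eq_smul_add θ u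
    obtain ⟨b, y₂, rfl⟩ := exists_eq_smul_add θ v
    simp only [orthogonalProjection_smul_add] at h
    subst h
    simp only [reflection_smul_add] at huv
    have h1 : ((a - b) / 2) • θ + (y₁ : E) = r • θ + (y : E) := by
      rw [← huv]; module
    obtain ⟨rfl, rfl⟩ := (smul_add_eq_iff hθ).1 h1
    exact ⟨a, hu, b, hv, rfl⟩
  · rintro ⟨a, ha, b, hb, rfl⟩
    refine ⟨(a • θ + (y : E), b • θ + (y : E)), ⟨⟨ha, hb⟩, ?_⟩, ?_⟩
    · simp only [orthogonalProjection_smul_add]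
    · simp only [reflection_smul_add]
      module

theorem lineFiber_steiner_eq_Icc {θ : E} (hθ : θ ≠ 0) {y : (ℝ ∙ θ)ᗮ} {L : Set E} {a b : ℝ}
    (h : lineFiber θ y L = Set.Icc a b) :
    lineFiber θ y (steiner θ L) = Set.Icc (-((b - a) / 2)) ((b - a) / 2) := by
  ext r
  rw [mem_lineFiber_steiner hθ, h]
  constructor
  · rintro ⟨c, ⟨hc, hc'⟩, d, ⟨hd, hd'⟩, rfl⟩
    exact ⟨by linarith, by linarith⟩
  · rintro ⟨h1, h2⟩
    exact ⟨(a + b) / 2 + r, ⟨by linarith, by linarith⟩, (a + b) / 2 - r,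
      ⟨by linarith, by linarith⟩, by ring⟩

theorem lineFiber_steiner_eq_empty {θ : E} (hθ : θ ≠ 0) {y : (ℝ ∙ θ)ᗮ} {L : Set E}
    (h : lineFiber θ y L = ∅) : lineFiber θ y (steiner θ L) = ∅ := by
  ext r
  simp [mem_lineFiber_steiner hθ, h]

theorem isCompact_steiner (θ : E) {L : Set E} (hL : IsCompact L) : IsCompact (steiner θ L) := by
  refine ((hL.prod hL).inter_right (isClosed_eq ?_ ?_)).image ?_ <;> fun_prop

theorem convex_steiner (θ : E) {L : Set E} (hL : Convex ℝ L) : Convex ℝ (steiner θ L) := by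
  rintro _ ⟨⟨u, v⟩, ⟨⟨hu, hv⟩, h⟩, rfl⟩ _ ⟨⟨u', v'⟩, ⟨⟨hu', hv'⟩, h'⟩, rfl⟩ a b ha hb hab
  refine ⟨(a • u + b • u', a • v + b • v'), ⟨⟨hL hu hu' ha hb hab, hL hv hv' ha hb hab⟩, ?_⟩, ?_⟩
  · simp only at h h' ⊢
    simp only [map_add, map_smul, h, h']
  · simp only [map_add, map_smul]
    module

theorem steiner_subset_closedBall (θ : E) {L : Set E} {r : ℝ}
    (h : L ⊆ Metric.closedBall 0 r) : steiner θ L ⊆ Metric.closedBall 0 r := by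
  rintro _ ⟨⟨u, v⟩, ⟨⟨hu, hv⟩, -⟩, rfl⟩
  have h1 := mem_closedBall_zero_iff.1 (h hu)
  have h2 := mem_closedBall_zero_iff.1 (h hv)
  rw [mem_closedBall_zero_iff, norm_smul]
  have h3 := norm_add_le u ((ℝ ∙ θ)ᗮ.reflection v)
  rw [LinearIsometryEquiv.norm_map] at h3
  norm_num
  linarith

theorem volume_lineFiber_steiner {θ : E} (hθ : θ ≠ 0) {L : Set E} (hL : IsCompact L)
    (hLc : Convex ℝ L) (y : (ℝ ∙ θ)ᗮ) :
    volume (lineFiber θ y (steiner θ L)) = volume (lineFiber θ y L) := by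
  rcases (lineFiber θ y L).eq_empty_or_nonempty with h | h
  · rw [lineFiber_steiner_eq_empty hθ h, h]
  · obtain ⟨a, b, -, h⟩ := exists_eq_Icc (isCompact_lineFiber hθ hL y) (convex_lineFiber hLc y) h
    rw [lineFiber_steiner_eq_Icc hθ h, h, Real.volume_Icc, Real.volume_Icc]
    congr 1
    ring

theorem lineFiber_closedBall_zero {θ : E} (hθ : θ ≠ 0) [FiniteDimensional ℝ E] (y : (ℝ ∙ θ)ᗮ)
    (ρ : ℝ) (h : (lineFiber θ y (Metric.closedBall 0 ρ)).Nonempty) :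
    ∃ c, lineFiber θ y (Metric.closedBall 0 ρ) = Set.Icc (-c) c := by
  obtain ⟨a, b, hab, h⟩ := exists_eq_Icc (isCompact_lineFiber hθ (isCompact_closedBall 0 ρ) y)
    (convex_lineFiber (convex_closedBall 0 ρ) y) h
  have hneg {r : ℝ} (hr : r ∈ Set.Icc a b) : -r ∈ Set.Icc a b := by
    rw [← h, mem_lineFiber, mem_closedBall_zero_iff] at hr ⊢
    rwa [← reflection_smul_add, LinearIsometryEquiv.norm_map]
  refine ⟨b, ?_⟩
  rw [h, le_antisymm (by linarith [(hneg (Set.left_mem_Icc.2 hab)).2])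
    (hneg (Set.right_mem_Icc.2 hab)).1]

variable [FiniteDimensional ℝ E] [MeasurableSpace E] [BorelSpace E]

theorem measure_steiner (μ : Measure E) [μ.IsAddHaarMeasure] {θ : E} (hθ : θ ≠ 0) {L : Set E}
    (hL : IsCompact L) (hLc : Convex ℝ L) : μ (steiner θ L) = μ L := by
  obtain ⟨ν, hν, hmp⟩ := exists_measurePreserving_smul_add μ hθ
  rw [measure_eq_lintegral_lineFiber hmp (isCompact_steiner θ hL).measurableSet,
    measure_eq_lintegral_lineFiber hmp hL.measurableSet]
  simp only [volume_lineFiber_steiner hθ hL hLc]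

theorem volume_diff_add_volume_inter_le {I J S : Set ℝ} (hI : MeasurableSet I)
    (hJ : MeasurableSet J) (hJt : volume J ≠ ⊤) (h : S ⊆ J ∨ J ⊆ S)
    (hSI : volume S = volume I) (t : ℝ) :
    volume (S \ J) + volume ((I \ J) ∩ {r | r - t ∈ J \ I}) ≤ volume (I \ J) := by
  rcases h with h | h
  · rw [Set.sdiff_eq_empty.2 h, measure_empty, zero_add]
    exact measure_mono Set.inter_subset_left
  · have h1 : volume ((I \ J) ∩ {r | r - t ∈ J \ I}) ≤ volume (J \ I) := by
      refine (measure_mono Set.inter_subset_right).trans_eq ?_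
      exact (measurePreserving_sub_right volume t).measure_preimage (hJ.diff hI).nullMeasurableSet
    have h2 : volume (S \ J) + volume J = volume (I \ J) + volume (I ∩ J) := by
      rw [measure_sdiff_add_inter I hJ, ← hSI, ← measure_sdiff_add_inter S hJ,
        Set.inter_eq_right.2 h]
    have h3 : volume J = volume (J \ I) + volume (I ∩ J) := by
      rw [Set.inter_comm, measure_sdiff_add_inter J hI]
    have h4 : volume (I ∩ J) ≠ ⊤ := measure_ne_top_of_subset Set.inter_subset_right hJt
    rw [h3, ← add_assoc] at h2
    exact (add_le_add_right h1 _).trans_eq ((ENNReal.add_left_inj h4).1 h2)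

theorem measure_steiner_diff_closedBall_add_le (μ : Measure E) [μ.IsAddHaarMeasure] {θ : E}
    (hθ : θ ≠ 0) {L : Set E} (hL : IsCompact L) (hLc : Convex ℝ L) (ρ : ℝ) :
    μ (steiner θ L \ Metric.closedBall 0 ρ) + μ ((L \ Metric.closedBall 0 ρ) ∩
      {x | x - θ ∈ Metric.closedBall 0 ρ \ L}) ≤ μ (L \ Metric.closedBall 0 ρ) := by
  obtain ⟨ν, hν, hmp⟩ := exists_measurePreserving_smul_add μ hθ
  set B := Metric.closedBall (0 : E) ρ
  have hB : MeasurableSet B := Metric.isClosed_closedBall.measurableSet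
  have hS := (isCompact_steiner θ hL).measurableSet.diff hB
  have hX : MeasurableSet ((L \ B) ∩ {x | x - θ ∈ B \ L}) :=
    (hL.measurableSet.diff hB).inter ((measurable_sub_const θ) (hB.diff hL.measurableSet))
  rw [measure_eq_lintegral_lineFiber hmp hS, measure_eq_lintegral_lineFiber hmp hX,
    measure_eq_lintegral_lineFiber hmp (hL.measurableSet.diff hB),
    ← lintegral_add_left (measurable_volume_lineFiber θ hS)]
  refine lintegral_mono fun y => ?_
  have hI := isCompact_lineFiber hθ hL y
  have hJ := isCompact_lineFiber hθ (isCompact_closedBall 0 ρ) y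
  have hset : lineFiber θ y ((L \ B) ∩ {x | x - θ ∈ B \ L}) =
      (lineFiber θ y L \ lineFiber θ y B) ∩ {r | r - 1 ∈ lineFiber θ y B \ lineFiber θ y L} := by
    ext r
    have : r • θ + (y : E) - θ = (r - 1) • θ + y := by module
    simp [mem_lineFiber, this]
  rw [hset]
  refine volume_diff_add_volume_inter_le (S := lineFiber θ y (steiner θ L)) hI.measurableSet
    hJ.measurableSet hJ.measure_lt_top.ne ?_ (volume_lineFiber_steiner hθ hL hLc y) 1
  rcases (lineFiber θ y B).eq_empty_or_nonempty with h | h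
  · exact Or.inr (h ▸ Set.empty_subset _)
  obtain ⟨c, hc⟩ := lineFiber_closedBall_zero hθ y ρ h
  rcases (lineFiber θ y L).eq_empty_or_nonempty with h' | h'
  · exact Or.inl (lineFiber_steiner_eq_empty hθ h' ▸ Set.empty_subset _)
  obtain ⟨a, b, -, h'⟩ := exists_eq_Icc hI (convex_lineFiber hLc y) h'
  rw [lineFiber_steiner_eq_Icc hθ h', hc]
  rcases le_total c ((b - a) / 2) with h | h
  · exact Or.inr (Set.Icc_subset_Icc (neg_le_neg h) h)
  · exact Or.inl (Set.Icc_subset_Icc (neg_le_neg h) h)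

end Steiner

theorem lintegral_measure_inter_sub_mem {E : Type*} [AddCommGroup E] [MeasurableSpace E]
    [MeasurableAdd₂ E] [MeasurableNeg E] (μ : Measure E) [SFinite μ] [μ.IsAddLeftInvariant]
    [μ.IsNegInvariant] {A D : Set E} (hA : MeasurableSet A)
    (hD : MeasurableSet D) : ∫⁻ z, μ (A ∩ {x | x - z ∈ D}) ∂μ = μ A * μ D := by
  have hs : MeasurableSet {p : E × E | p.1 ∈ A ∧ p.1 - p.2 ∈ D} :=
    (measurable_fst hA).inter ((measurable_fst.sub measurable_snd) hD)
  have h1 := Measure.prod_apply (μ := μ) (ν := μ) hs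
  rw [Measure.prod_apply_symm hs] at h1
  refine Eq.trans h1 ?_
  have h2 (x : E) : μ (Prod.mk x ⁻¹' {p : E × E | p.1 ∈ A ∧ p.1 - p.2 ∈ D}) =
      A.indicator (fun _ => μ D) x := by
    by_cases hx : x ∈ A
    · rw [Set.indicator_of_mem hx,
        ← (Measure.measurePreserving_sub_left μ x).measure_preimage hD.nullMeasurableSet]
      congr 1
      ext z
      simp [hx]
    · rw [Set.indicator_of_notMem hx]
      simp [hx]
  simp only [h2]
  rw [lintegral_indicator hA, setLIntegral_const, mul_comm]

section SteinerDecrease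

variable {E : Type*} [NormedAddCommGroup E] [InnerProductSpace ℝ E] [FiniteDimensional ℝ E]
  [MeasurableSpace E] [BorelSpace E]

theorem exists_mul_div_le_measure_inter_sub_mem (μ : Measure E) [μ.IsAddHaarMeasure] {A D : Set E}
    (hA : MeasurableSet A) (hD : MeasurableSet D) {r : ℝ} (hr : 0 < r)
    (hAr : A ⊆ Metric.closedBall 0 r) (hDr : D ⊆ Metric.closedBall 0 r) :
    ∃ z, μ A * μ D / μ (Metric.closedBall 0 (2 * r)) ≤ μ (A ∩ {x | x - z ∈ D}) := by
  have hfin (s : Set E) (hs : s ⊆ Metric.closedBall 0 r) : μ s ≠ ⊤ :=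
    measure_ne_top_of_subset hs measure_closedBall_lt_top.ne
  have hsupp (z : E) (hz : z ∉ Metric.closedBall (0 : E) (2 * r)) :
      μ (A ∩ {x | x - z ∈ D}) = 0 := by
    convert measure_empty (μ := μ)
    rw [Set.eq_empty_iff_forall_notMem]
    rintro x ⟨hx, hx'⟩
    apply hz
    have h1 := mem_closedBall_zero_iff.1 (hAr hx)
    have h2 := mem_closedBall_zero_iff.1 (hDr hx')
    have h3 := norm_sub_le x (x - z)
    rw [sub_sub_cancel] at h3
    rw [mem_closedBall_zero_iff]
    linarith
  have hfi : ∫⁻ z in Metric.closedBall 0 (2 * r), μ (A ∩ {x | x - z ∈ D}) ∂μ = μ A * μ D := by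
    rw [← lintegral_measure_inter_sub_mem μ hA hD]
    exact setLIntegral_eq_of_support_subset fun z hz => by_contra fun h => hz (hsupp z h)
  obtain ⟨z, -, hz⟩ := exists_setLAverage_le (μ := μ) (s := Metric.closedBall (0 : E) (2 * r))
    (f := fun z => μ (A ∩ {x | x - z ∈ D}))
    (Metric.measure_closedBall_pos μ 0 (by positivity)).ne'
    Metric.isClosed_closedBall.measurableSet.nullMeasurableSet
    (by rw [hfi]; exact ENNReal.mul_ne_top (hfin A hAr) (hfin D hDr))
  exact ⟨z, by rwa [setLAverage_eq, hfi] at hz⟩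

theorem exists_measure_steiner_diff_add_le (μ : Measure E) [μ.IsAddHaarMeasure] {L : Set E}
    (hL : IsCompact L) (hLc : Convex ℝ L) {ρ r : ℝ} (hr : 0 < r)
    (hLr : L ⊆ Metric.closedBall 0 r) (hρ : ρ ≤ r) (hμ : μ L = μ (Metric.closedBall 0 ρ))
    (hpos : μ (L \ Metric.closedBall 0 ρ) ≠ 0) :
    ∃ θ : E, θ ≠ 0 ∧ μ (steiner θ L \ Metric.closedBall 0 ρ) +
      μ (L \ Metric.closedBall 0 ρ) ^ 2 / μ (Metric.closedBall 0 (2 * r)) ≤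
        μ (L \ Metric.closedBall 0 ρ) := by
  have hB : MeasurableSet (Metric.closedBall (0 : E) ρ) := Metric.isClosed_closedBall.measurableSet
  have hBr : Metric.closedBall (0 : E) ρ ⊆ Metric.closedBall 0 r :=
    Metric.closedBall_subset_closedBall hρ
  have hVt : μ (Metric.closedBall 0 (2 * r)) ≠ ⊤ := measure_closedBall_lt_top.ne
  have hsymm : μ (Metric.closedBall 0 ρ \ L) = μ (L \ Metric.closedBall 0 ρ) :=
    measure_sdiff_symm hB.nullMeasurableSet hL.measurableSet.nullMeasurableSet hμ.symm
      (measure_ne_top_of_subset Set.inter_subset_right hL.measure_lt_top.ne)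
  obtain ⟨θ, hθ⟩ := exists_mul_div_le_measure_inter_sub_mem μ (hL.measurableSet.diff hB)
    (hB.diff hL.measurableSet) hr (Set.sdiff_subset.trans hLr) (Set.sdiff_subset.trans hBr)
  rw [hsymm, ← sq] at hθ
  have hθ0 : θ ≠ 0 := by
    rintro rfl
    have : (L \ Metric.closedBall 0 ρ) ∩ {x | x - 0 ∈ Metric.closedBall 0 ρ \ L} = ∅ := by
      ext x
      simp +contextual
    rw [this, measure_empty, nonpos_iff_eq_zero, ENNReal.div_eq_zero_iff] at hθ
    exact hθ.elim (pow_ne_zero 2 hpos) hVt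
  exact ⟨θ, hθ0, (add_le_add_right hθ _).trans
    (measure_steiner_diff_closedBall_add_le μ hθ0 hL hLc ρ)⟩

end SteinerDecrease

section SteinerConvergence

variable {E : Type*} [NormedAddCommGroup E] [InnerProductSpace ℝ E] [FiniteDimensional ℝ E]
  [MeasurableSpace E] [BorelSpace E]

theorem exists_measure_diff_closedBall_lt (μ : Measure E) [μ.IsAddHaarMeasure]
    {P : Set E → Prop} (hP : ∀ L θ, IsCompact L → Convex ℝ L → θ ≠ 0 → P L → P (steiner θ L))
    {ρ r : ℝ} (hr : 0 < r) (hρ : ρ ≤ r) {L : Set E} (hL : IsCompact L) (hLc : Convex ℝ L)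
    (hLP : P L) (hLr : L ⊆ Metric.closedBall 0 r) (hμ : μ L = μ (Metric.closedBall 0 ρ))
    {ε : ENNReal} (hε : ε ≠ 0) :
    ∃ L', IsCompact L' ∧ Convex ℝ L' ∧ P L' ∧ L' ⊆ Metric.closedBall 0 r ∧
      μ L' = μ (Metric.closedBall 0 ρ) ∧ μ (L' \ Metric.closedBall 0 ρ) < ε := by
  by_contra! hcon
  have hVt : μ (Metric.closedBall 0 (2 * r)) ≠ ⊤ := measure_closedBall_lt_top.ne
  set c := ε ^ 2 / μ (Metric.closedBall 0 (2 * r)) with hc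
  have hc0 : c ≠ 0 := by
    rw [hc, Ne, ENNReal.div_eq_zero_iff]
    exact fun h => h.elim (pow_ne_zero 2 hε) hVt
  have hstep (k : ℕ) : ∃ L', IsCompact L' ∧ Convex ℝ L' ∧ P L' ∧ L' ⊆ Metric.closedBall 0 r ∧
      μ L' = μ (Metric.closedBall 0 ρ) ∧
        μ (L' \ Metric.closedBall 0 ρ) + k * c ≤ μ (L \ Metric.closedBall 0 ρ) := by
    induction k with
    | zero => exact ⟨L, hL, hLc, hLP, hLr, hμ, by simp⟩
    | succ k ih =>
      obtain ⟨T, hT, hTc, hTP, hTr, hTμ, hle⟩ := ih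
      have hεT := hcon T hT hTc hTP hTr hTμ
      obtain ⟨θ, hθ, h⟩ := exists_measure_steiner_diff_add_le μ hT hTc hr hTr hρ hTμ
        (pos_iff_ne_zero.2 hε |>.trans_le hεT).ne'
      refine ⟨steiner θ T, isCompact_steiner θ hT, convex_steiner θ hTc, hP T θ hT hTc hθ hTP,
        steiner_subset_closedBall θ hTr, (measure_steiner μ hθ hT hTc).trans hTμ, ?_⟩
      calc μ (steiner θ T \ Metric.closedBall 0 ρ) + (k + 1 : ℕ) * c
          = μ (steiner θ T \ Metric.closedBall 0 ρ) + c + k * c := by push_cast; ring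
        _ ≤ μ (T \ Metric.closedBall 0 ρ) + k * c := by
          refine add_le_add_left (le_trans ?_ h) _
          rw [hc]
          gcongr
        _ ≤ _ := hle
  have hfin : μ (L \ Metric.closedBall 0 ρ) ≠ ⊤ :=
    measure_ne_top_of_subset Set.sdiff_subset hL.measure_lt_top.ne
  obtain ⟨k, hk⟩ := ENNReal.exists_nat_mul_gt hc0 hfin
  obtain ⟨T, -, -, -, -, -, hle⟩ := hstep k
  exact absurd (le_add_self.trans hle) hk.not_ge

end SteinerConvergence

section ProductIntegrals

theorem integrableOn_of_abs_le {X : Type*} [MeasurableSpace X] {μ : Measure X} {f : X → ℝ}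
    {s : Set X} {M : ℝ} (hf : Measurable f) (hs : MeasurableSet s) (hμ : μ s ≠ ⊤)
    (h : ∀ x ∈ s, |f x| ≤ M) : IntegrableOn f s μ :=
  Measure.integrableOn_of_bounded hμ hf.aestronglyMeasurable
    ((ae_restrict_iff' hs).2 (Filter.Eventually.of_forall h))

/-- A function that is even and midpoint convex has a smaller integral over a centered box than
over any translate of the box. -/
theorem setIntegral_Icc_neg_le {N : ℕ} {f : (Fin N → ℝ) → ℝ} {a b : Fin N → ℝ}
    (hf : ∀ u v, IntegrableOn f (Set.Icc u v)) (heven : ∀ t, f (-t) = f t)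
    (hmid : ∀ t s, 2 * f t ≤ f (t + s) + f (t - s)) :
    ∫ t in Set.Icc (-((2⁻¹ : ℝ) • (b - a))) ((2⁻¹ : ℝ) • (b - a)), f t ≤
      ∫ t in Set.Icc a b, f t := by
  set l := (2⁻¹ : ℝ) • (b - a) with hl
  set m := (2⁻¹ : ℝ) • (a + b) with hm
  have ha : a - m = -l := by rw [hl, hm]; module
  have hb : b - m = l := by rw [hl, hm]; module
  have hadd : (fun t => t + m) ⁻¹' Set.Icc a b = Set.Icc (-l) l := by
    rw [Set.preimage_add_const_Icc, ha, hb]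
  have hemb := (Homeomorph.addRight m).measurableEmbedding
  have hmp := measurePreserving_add_right (volume : Measure (Fin N → ℝ)) m
  have h1 : ∫ t in Set.Icc (-l) l, f (t + m) = ∫ t in Set.Icc a b, f t := by
    rw [← hadd]
    exact hmp.setIntegral_preimage_emb hemb f _
  have i1 : IntegrableOn (fun t => f (t + m)) (Set.Icc (-l) l) := by
    rw [← hadd]
    exact (hmp.integrableOn_comp_preimage hemb).2 (hf a b)
  have hneg : (fun t : Fin N → ℝ => -t) ⁻¹' Set.Icc (-l) l = Set.Icc (-l) l := by
    ext t
    exact ⟨fun h => ⟨neg_le.1 h.2, neg_le_neg_iff.1 h.1⟩,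
      fun h => ⟨neg_le_neg h.2, neg_le.1 h.1⟩⟩
  have hemb' := (Homeomorph.neg (Fin N → ℝ)).measurableEmbedding
  have hmp' := Measure.measurePreserving_neg (volume : Measure (Fin N → ℝ))
  have hsub (t : Fin N → ℝ) : f (-t + m) = f (t - m) := by
    rw [← heven]; congr 1; abel
  have h2 : ∫ t in Set.Icc (-l) l, f (t - m) = ∫ t in Set.Icc a b, f t := by
    rw [← h1]
    conv_lhs => rw [← hneg]
    simp only [← hsub]
    exact hmp'.setIntegral_preimage_emb hemb' (fun t => f (t + m)) _
  have i2 : IntegrableOn (fun t => f (t - m)) (Set.Icc (-l) l) := by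
    rw [← hneg]
    simp only [← hsub]
    exact (hmp'.integrableOn_comp_preimage hemb').2 i1
  have h3 : ∫ t in Set.Icc (-l) l, 2 * f t ≤ ∫ t in Set.Icc (-l) l, (f (t + m) + f (t - m)) :=
    setIntegral_mono ((hf _ _).const_mul 2) (i1.add i2) fun t => hmid t m
  rw [integral_const_mul, integral_add i1 i2, h1, h2] at h3
  linarith

theorem measurePreserving_pi_smul_add {E : Type*} [NormedAddCommGroup E] [InnerProductSpace ℝ E]
    [FiniteDimensional ℝ E] [MeasurableSpace E] [BorelSpace E] (N : ℕ) {μ : Measure E}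
    [μ.IsAddHaarMeasure] {θ : E} {ν : Measure (ℝ ∙ θ)ᗮ} [ν.IsAddHaarMeasure]
    (h : MeasurePreserving (fun p : ℝ × (ℝ ∙ θ)ᗮ => p.1 • θ + (p.2 : E)) (volume.prod ν) μ) :
    MeasurePreserving (fun (p : (Fin N → ℝ) × (Fin N → (ℝ ∙ θ)ᗮ)) j => p.1 j • θ + (p.2 j : E))
      (volume.prod (Measure.pi fun _ => ν)) (Measure.pi fun _ => μ) :=
  (measurePreserving_pi (fun _ : Fin N => (volume : Measure ℝ).prod ν) (fun _ => μ)
    fun _ => h).comp ((measurePreserving_arrowProdEquivProdArrow ℝ (ℝ ∙ θ)ᗮ (Fin N)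
      (fun _ => volume) fun _ => ν).symm _)

theorem integral_pi_restrict_eq_integral_lineFiber {E : Type*} [NormedAddCommGroup E]
    [InnerProductSpace ℝ E] [FiniteDimensional ℝ E] [MeasurableSpace E] [BorelSpace E] {N : ℕ}
    {μ : Measure E} [μ.IsAddHaarMeasure] {θ : E} {ν : Measure (ℝ ∙ θ)ᗮ} [ν.IsAddHaarMeasure]
    (h : MeasurePreserving (fun p : ℝ × (ℝ ∙ θ)ᗮ => p.1 • θ + (p.2 : E)) (volume.prod ν) μ)
    {F : (Fin N → E) → ℝ} (hF : Measurable F) {L : Set E} (hL : MeasurableSet L)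
    (hfi : IntegrableOn F (Set.univ.pi fun _ => L) (Measure.pi fun _ => μ)) :
    Integrable (fun y : Fin N → (ℝ ∙ θ)ᗮ => ∫ t in Set.univ.pi fun j => lineFiber θ (y j) L,
        F fun j => t j • θ + (y j : E)) (Measure.pi fun _ => ν) ∧
      ∫ x, F x ∂(Measure.pi fun _ => μ.restrict L) =
        ∫ y : Fin N → (ℝ ∙ θ)ᗮ, (∫ t in Set.univ.pi fun j => lineFiber θ (y j) L,
          F fun j => t j • θ + (y j : E)) ∂(Measure.pi fun _ => ν) := by
  have hmp := measurePreserving_pi_smul_add N h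
  have hpi : MeasurableSet (Set.univ.pi fun _ : Fin N => L) := MeasurableSet.univ_pi fun _ => hL
  set G := (Set.univ.pi fun _ : Fin N => L).indicator F with hG
  have hGm : Measurable G := hF.indicator hpi
  have hGi := (hmp.integrable_comp hGm.aestronglyMeasurable).2
    ((integrable_indicator_iff hpi).2 hfi)
  have hfib (y : Fin N → (ℝ ∙ θ)ᗮ) :
      ∫ t in Set.univ.pi fun j => lineFiber θ (y j) L, F (fun j => t j • θ + (y j : E)) =
        ∫ t : Fin N → ℝ, G fun j => t j • θ + (y j : E) := by
    have hm : MeasurableSet (Set.univ.pi fun j => lineFiber θ (y j) L) :=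
      MeasurableSet.univ_pi fun j =>
        (by fun_prop : Measurable fun r : ℝ => r • θ + (y j : E)) hL
    rw [← integral_indicator hm]
    rfl
  simp only [hfib]
  refine ⟨hGi.integral_prod_right, ?_⟩
  rw [← Measure.restrict_pi_pi, ← integral_indicator hpi, ← hmp.map_eq,
    integral_map hmp.measurable.aemeasurable hGm.aestronglyMeasurable]
  exact integral_prod_symm _ hGi

theorem integral_pi_restrict_steiner_le {E : Type*} [NormedAddCommGroup E]
    [InnerProductSpace ℝ E] [FiniteDimensional ℝ E] [MeasurableSpace E] [BorelSpace E] {N : ℕ}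
    (μ : Measure E) [μ.IsAddHaarMeasure] {θ : E} (hθ : θ ≠ 0) {F : (Fin N → E) → ℝ}
    (hF : Measurable F) (hFb : ∀ X, IsCompact X → ∃ M, ∀ x ∈ X, |F x| ≤ M)
    (hrefl : ∀ x, F (fun j => (ℝ ∙ θ)ᗮ.reflection (x j)) = F x)
    (hmid : ∀ (x : Fin N → E) (t : Fin N → ℝ),
      2 * F x ≤ F (fun j => x j + t j • θ) + F fun j => x j - t j • θ)
    {L : Set E} (hL : IsCompact L) (hLc : Convex ℝ L) :
    ∫ x, F x ∂(Measure.pi fun _ => μ.restrict (steiner θ L)) ≤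
      ∫ x, F x ∂(Measure.pi fun _ => μ.restrict L) := by
  obtain ⟨ν, hν, hmp⟩ := exists_measurePreserving_smul_add μ hθ
  have hfi {T : Set E} (hT : IsCompact T) :
      IntegrableOn F (Set.univ.pi fun _ => T) (Measure.pi fun _ => μ) := by
    have hX : IsCompact (Set.univ.pi fun _ : Fin N => T) := isCompact_univ_pi fun _ => hT
    obtain ⟨M, hM⟩ := hFb _ hX
    exact integrableOn_of_abs_le hF hX.measurableSet hX.measure_lt_top.ne hM
  obtain ⟨i1, e1⟩ := integral_pi_restrict_eq_integral_lineFiber hmp hF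
    (isCompact_steiner θ hL).measurableSet (hfi (isCompact_steiner θ hL))
  obtain ⟨i2, e2⟩ := integral_pi_restrict_eq_integral_lineFiber hmp hF hL.measurableSet (hfi hL)
  rw [e1, e2]
  refine integral_mono i1 i2 fun y => ?_
  by_cases hy : ∃ j, lineFiber θ (y j) L = ∅
  · obtain ⟨j, hj⟩ := hy
    have h1 : (Set.univ.pi fun j => lineFiber θ (y j) (steiner θ L)) = ∅ :=
      Set.univ_pi_eq_empty (lineFiber_steiner_eq_empty hθ hj)
    have h2 : (Set.univ.pi fun j => lineFiber θ (y j) L) = ∅ := Set.univ_pi_eq_empty hj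
    simp only [h1, h2, le_refl]
  · push Not at hy
    choose a b hab h using fun j => exists_eq_Icc (isCompact_lineFiber hθ hL (y j))
      (convex_lineFiber hLc (y j)) (hy j)
    have h2 : (Set.univ.pi fun j => lineFiber θ (y j) L) = Set.Icc a b := by
      simp only [h, Set.pi_univ_Icc]
    have h1 : (Set.univ.pi fun j => lineFiber θ (y j) (steiner θ L)) =
        Set.Icc (-((2⁻¹ : ℝ) • (b - a))) ((2⁻¹ : ℝ) • (b - a)) := by
      rw [← Set.pi_univ_Icc]
      congr 1
      ext1 j
      rw [lineFiber_steiner_eq_Icc hθ (h j)]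
      simp [div_eq_inv_mul]
    simp only [h1, h2]
    have hcont : Continuous fun (t : Fin N → ℝ) j => t j • θ + (y j : E) := by fun_prop
    refine setIntegral_Icc_neg_le (f := fun t => F fun j => t j • θ + (y j : E))
      (fun u v => ?_) (fun t => ?_) (fun t s => ?_)
    · obtain ⟨M, hM⟩ := hFb _ ((isCompact_Icc (a := u) (b := v)).image hcont)
      exact integrableOn_of_abs_le (hF.comp hcont.measurable) measurableSet_Icc
        isCompact_Icc.measure_lt_top.ne fun t ht => hM _ ⟨t, ht, rfl⟩
    · rw [← hrefl fun j => t j • θ + (y j : E)]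
      simp only [reflection_smul_add, Pi.neg_apply]
    · convert hmid (fun j => t j • θ + (y j : E)) s using 4
      · rw [Pi.add_apply]; module
      · rw [Pi.sub_apply]; module

end ProductIntegrals

section Rearrangement

theorem setIntegral_le_setIntegral_add {X : Type*} [MeasurableSpace X] {μ : Measure X}
    {f : X → ℝ} {s t : Set X} {M : ℝ} (hs : MeasurableSet s) (ht : MeasurableSet t)
    (hfs : IntegrableOn f s μ) (hft : IntegrableOn f t μ) (hμs : μ s ≠ ⊤) (hμt : μ t ≠ ⊤)
    (hM : ∀ x ∈ s ∪ t, |f x| ≤ M) :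
    ∫ x in s, f x ∂μ ≤ ∫ x in t, f x ∂μ + M * (μ.real (s \ t) + μ.real (t \ s)) := by
  have h1 := integral_inter_add_sdiff ht hfs
  have h2 := integral_inter_add_sdiff hs hft
  rw [Set.inter_comm] at h2
  have h3 := norm_setIntegral_le_of_norm_le_const (μ := μ) (s := s \ t) (f := f) (C := M)
    (measure_ne_top_of_subset Set.sdiff_subset hμs).lt_top fun x hx => hM x (Or.inl hx.1)
  have h4 := norm_setIntegral_le_of_norm_le_const (μ := μ) (s := t \ s) (f := f) (C := M)
    (measure_ne_top_of_subset Set.sdiff_subset hμt).lt_top fun x hx => hM x (Or.inr hx.1)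
  rw [Real.norm_eq_abs] at h3 h4
  linarith [le_of_abs_le h3, neg_le_of_abs_le h4]

theorem measureReal_pi_sdiff_pi {E : Type*} [MeasurableSpace E] (μ : Measure E) [SigmaFinite μ]
    (N : ℕ) {s t : Set E} (ht : MeasurableSet t) (hμ : μ s ≠ ⊤) :
    (Measure.pi fun _ : Fin N => μ).real ((Set.univ.pi fun _ => s) \ Set.univ.pi fun _ => t) =
      μ.real s ^ N - (μ.real s - μ.real (s \ t)) ^ N := by
  have hpi (u : Set E) : (Measure.pi fun _ : Fin N => μ).real (Set.univ.pi fun _ => u) =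
      μ.real u ^ N := by
    simp [measureReal_def, Measure.pi_pi]
  have hfin : (Measure.pi fun _ : Fin N => μ) (Set.univ.pi fun _ => s) ≠ ⊤ := by
    rw [Measure.pi_pi]
    exact ENNReal.prod_ne_top fun _ _ => hμ
  have h1 := measureReal_inter_add_sdiff (μ := Measure.pi fun _ : Fin N => μ)
    (s := Set.univ.pi fun _ => s) (MeasurableSet.univ_pi fun _ : Fin N => ht) hfin
  have h2 := measureReal_inter_add_sdiff (μ := μ) (s := s) ht hμ
  rw [← Set.pi_inter_distrib, hpi, hpi] at h1
  rw [← h1, ← h2]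
  ring

/-- Among compact convex sets of given measure, the centered ball minimizes the integral over the
`N`-fold power of a function that is invariant under simultaneous reflections and midpoint convex
along parallel movements of its arguments. -/
theorem integral_pi_restrict_closedBall_le {E : Type*} [NormedAddCommGroup E]
    [InnerProductSpace ℝ E] [FiniteDimensional ℝ E] [MeasurableSpace E] [BorelSpace E] {N : ℕ}
    (μ : Measure E) [μ.IsAddHaarMeasure] {F : (Fin N → E) → ℝ} (hF : Measurable F)
    (hFb : ∀ X, IsCompact X → ∃ M, ∀ x ∈ X, |F x| ≤ M)
    (hrefl : ∀ (θ : E) x, F (fun j => (ℝ ∙ θ)ᗮ.reflection (x j)) = F x)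
    (hmid : ∀ (θ : E) (x : Fin N → E) (t : Fin N → ℝ),
      2 * F x ≤ F (fun j => x j + t j • θ) + F fun j => x j - t j • θ)
    {K : Set E} (hK : IsCompact K) (hKc : Convex ℝ K) {ρ : ℝ}
    (hμ : μ K = μ (Metric.closedBall 0 ρ)) :
    ∫ x, F x ∂(Measure.pi fun _ => μ.restrict (Metric.closedBall 0 ρ)) ≤
      ∫ x, F x ∂(Measure.pi fun _ => μ.restrict K) := by
  obtain ⟨r₀, hr₀⟩ := hK.isBounded.subset_closedBall 0
  set r := max (max r₀ ρ) 1
  have hr : 0 < r := lt_max_of_lt_right one_pos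
  have hρ : ρ ≤ r := (le_max_right _ _).trans (le_max_left _ _)
  have hKr : K ⊆ Metric.closedBall 0 r :=
    hr₀.trans (Metric.closedBall_subset_closedBall ((le_max_left _ _).trans (le_max_left _ _)))
  obtain ⟨M, hM⟩ := hFb (Set.univ.pi fun _ => Metric.closedBall 0 r)
    (isCompact_univ_pi fun _ => isCompact_closedBall 0 r)
  set B := Metric.closedBall (0 : E) ρ
  have hB : IsCompact B := isCompact_closedBall 0 ρ
  have hBr : B ⊆ Metric.closedBall 0 r := Metric.closedBall_subset_closedBall hρ
  have key (k : ℕ) := exists_measure_diff_closedBall_lt μ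
    (P := fun L => ∫ x, F x ∂(Measure.pi fun _ => μ.restrict L) ≤
      ∫ x, F x ∂(Measure.pi fun _ => μ.restrict K))
    (fun L θ hL hLc hθ hLP => (integral_pi_restrict_steiner_le μ hθ hF hFb (hrefl θ) (hmid θ)
      hL hLc).trans hLP) hr hρ hK hKc le_rfl hKr hμ
    (ε := ENNReal.ofReal (1 / ((k : ℝ) + 1))) (by
      rw [Ne, ENNReal.ofReal_eq_zero, not_le]
      positivity)
  choose L hL hLc hLP hLr hLμ hLε using key
  have hd : Filter.Tendsto (fun k => μ.real (L k \ B)) Filter.atTop (nhds 0) := by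
    refine squeeze_zero (fun k => measureReal_nonneg) (fun k => ?_)
      tendsto_one_div_add_atTop_nhds_zero_nat
    exact ENNReal.toReal_le_of_le_ofReal (by positivity) (hLε k).le
  have hlim := ((((hd.const_sub (μ.real B)).pow N).const_sub (μ.real B ^ N)).const_mul
    (M * 2)).const_add (∫ x, F x ∂(Measure.pi fun _ => μ.restrict K))
  rw [sub_zero, sub_self, mul_zero, add_zero] at hlim
  refine ge_of_tendsto' hlim fun k => ?_
  have hpi {T : Set E} (hT : IsCompact T) : IsCompact (Set.univ.pi fun _ : Fin N => T) :=
    isCompact_univ_pi fun _ => hT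
  have hMT {T : Set E} (hT : T ⊆ Metric.closedBall 0 r) :
      ∀ x ∈ Set.univ.pi fun _ : Fin N => T, |F x| ≤ M :=
    fun x hx => hM x (Set.pi_mono (fun _ _ => hT) hx)
  have hfi {T : Set E} (hT : IsCompact T) (hTr : T ⊆ Metric.closedBall 0 r) :
      IntegrableOn F (Set.univ.pi fun _ => T) (Measure.pi fun _ => μ) :=
    integrableOn_of_abs_le hF (hpi hT).measurableSet (hpi hT).measure_lt_top.ne (hMT hTr)
  have hsymm : μ.real (B \ L k) = μ.real (L k \ B) := by
    rw [measureReal_def, measureReal_def]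
    congr 1
    exact measure_sdiff_symm hB.measurableSet.nullMeasurableSet
      (hL k).measurableSet.nullMeasurableSet (hLμ k).symm
      (measure_ne_top_of_subset Set.inter_subset_right (hL k).measure_lt_top.ne)
  have hreal : μ.real (L k) = μ.real B := by rw [measureReal_def, hLμ k, measureReal_def]
  have h := setIntegral_le_setIntegral_add (hpi hB).measurableSet (hpi (hL k)).measurableSet
    (hfi hB hBr) (hfi (hL k) (hLr k)) (hpi hB).measure_lt_top.ne (hpi (hL k)).measure_lt_top.ne
    (fun x hx => hx.elim (hMT hBr x) (hMT (hLr k) x))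
  rw [Measure.restrict_pi_pi, Measure.restrict_pi_pi,
    measureReal_pi_sdiff_pi μ N (hL k).measurableSet hB.measure_lt_top.ne,
    measureReal_pi_sdiff_pi μ N hB.measurableSet (hL k).measure_lt_top.ne,
    hsymm, hreal] at h
  linarith [hLP k]

theorem volume_ballSameVol {n : ℕ} (hn : 0 < n) {K : Set (EuclideanSpace ℝ (Fin n))}
    (hK : volume K ≠ ⊤) : volume (ballSameVol n K) = volume K := by
  set v := (volume (Metric.closedBall (0 : EuclideanSpace ℝ (Fin n)) 1)).toReal
  have hB : volume (Metric.closedBall (0 : EuclideanSpace ℝ (Fin n)) 1) ≠ ⊤ :=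
    measure_closedBall_lt_top.ne
  have hv : 0 < v := ENNReal.toReal_pos (Metric.measure_closedBall_pos volume 0 one_pos).ne' hB
  rw [ballSameVol, Measure.addHaar_closedBall' _ _ (by positivity), finrank_euclideanSpace_fin,
    one_div, Real.rpow_inv_natCast_pow (by positivity) hn.ne',
    ENNReal.ofReal_div_of_pos hv, ENNReal.ofReal_toReal hB, ENNReal.ofReal_toReal hK,
    ENNReal.div_mul_cancel (Metric.measure_closedBall_pos volume 0 one_pos).ne' hB]

end Rearrangement

/-- (Hartzoulaki–Paouris type inequality, `M`-combination form.) For independent random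
points `X₁,…,X_N` uniform on a convex body `K` and `X₁*,…,X_N*` uniform on the centered ball
`B_K` of the same volume, and `C ⊂ ℝ^N` a convex body in the nonnegative orthant,
`E[W_i([X₁,…,X_N]C)] ≥ E[W_i([X₁*,…,X_N*]C)]` for all `0 ≤ i ≤ n-1`.  Expectations are
written as normalized integrals against the product of the restricted volumes. -/
theorem expected_quermass_MComb_ge {n N : ℕ} (hn : 0 < n)
    (K : Set (EuclideanSpace ℝ (Fin n))) (hKcomp : IsCompact K) (hKconv : Convex ℝ K)
    (hKint : (interior K).Nonempty)
    (C : Set (Fin N → ℝ)) (hCconv : Convex ℝ C) (hCcomp : IsCompact C)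
    (hCne : C.Nonempty) (hCpos : ∀ c ∈ C, ∀ j, 0 ≤ c j)
    (i : ℕ) (hi : i < n) :
    ((volume K).toReal ^ N)⁻¹ *
        ∫ x : Fin N → EuclideanSpace ℝ (Fin n),
          quermass n i ((fun c : Fin N → ℝ => ∑ j, c j • x j) '' C)
          ∂(Measure.pi fun _ => volume.restrict K)
      ≥ ((volume (ballSameVol n K)).toReal ^ N)⁻¹ *
        ∫ x : Fin N → EuclideanSpace ℝ (Fin n),
          quermass n i ((fun c : Fin N → ℝ => ∑ j, c j • x j) '' C)
          ∂(Measure.pi fun _ => volume.restrict (ballSameVol n K)) := by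
  have hvol := volume_ballSameVol hn hKcomp.measure_lt_top.ne
  rw [hvol]
  refine mul_le_mul_of_nonneg_left ?_ (by positivity)
  exact integral_pi_restrict_closedBall_le volume
    (measurable_quermass_combImage n i hCcomp hCconv hCne)
    (fun X hX => exists_abs_quermass_combImage_le n i hCcomp hCconv hCne hX)
    (fun θ x => quermass_combImage_linearIsometryEquiv i C _ x)
    (fun θ x t => two_mul_quermass_combImage_le hi hCcomp hCconv hCne x t θ)
    hKcomp hKconv hvol.symm
end

section
/- (Convexity of the perimeter-gauge along linear parameter systems with a moving segment) Let {K(t)}_{t∈I} be a linear parameter system in direction u ∈ S^{n-1}, i.e., K(t) = conv{ x_j + λ_j t u : j ∈ J } for bounded families {x_j} ⊂ ℝⁿ, {λ_j} ⊂ ℝ, and let w ∈ u^⊥, r, r' ∈ ℝ. Then the function (t, s) ↦ n·V(K(t)[n−1], [0, w + ((1−s)r + s r')u]) is jointly convex on I × [0,1]. -/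
open MeasureTheory
open scoped Pointwise BigOperators RealInnerProductSpace

theorem Convex.volume_eq_ofReal_sSup_sub_sInf {J : Set ℝ} (hc : Convex ℝ J)
    (hb : Bornology.IsBounded J) (hne : J.Nonempty) :
    volume J = ENNReal.ofReal (sSup J - sInf J) := by
  apply le_antisymm
  · rw [← Real.volume_Icc]
    exact measure_mono fun a ha => ⟨csInf_le hb.bddBelow ha, le_csSup hb.bddAbove ha⟩
  · rw [← Real.volume_Ioo]
    refine measure_mono fun a ha => ?_
    obtain ⟨b, hbJ, hba⟩ := exists_lt_of_csInf_lt hne ha.1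
    obtain ⟨c, hcJ, hac⟩ := exists_lt_of_lt_csSup hne ha.2
    exact hc.ordConnected.out hbJ hcJ ⟨hba.le, hac.le⟩

theorem Convex.volume_add_segment {J : Set ℝ} (hc : Convex ℝ J)
    (hb : Bornology.IsBounded J) (hne : J.Nonempty) (c : ℝ) :
    volume (J + segment ℝ 0 c) = volume J + ENNReal.ofReal |c| := by
  have hsc : IsCompact (segment ℝ (0 : ℝ) c) := by rw [segment_eq_uIcc]; exact isCompact_uIcc
  have hsn : (segment ℝ (0 : ℝ) c).Nonempty := ⟨0, left_mem_segment ℝ 0 c⟩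
  rw [(hc.add (convex_segment 0 c)).volume_eq_ofReal_sSup_sub_sInf (hb.add hsc.isBounded)
    (hne.add hsn), hc.volume_eq_ofReal_sSup_sub_sInf hb hne,
    csSup_add hne hb.bddAbove hsn hsc.bddAbove, csInf_add hne hb.bddBelow hsn hsc.bddBelow,
    ← ENNReal.ofReal_add (sub_nonneg.2 <| csInf_le_csSup hne hb.bddBelow hb.bddAbove)
      (abs_nonneg c), segment_eq_uIcc, Set.uIcc, csSup_Icc inf_le_sup, csInf_Icc inf_le_sup,
      ← sub_zero c, ← max_sub_min_eq_abs]
  congr 1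
  simp only [max_comm, min_comm, sub_zero]
  ring

theorem Convex.volume_le_of_subset_smul_add_smul {J A B : Set ℝ} (hA : Convex ℝ A)
    (hB : Convex ℝ B) (hAb : Bornology.IsBounded A) (hBb : Bornology.IsBounded B) {α β : ℝ}
    (hα : 0 ≤ α) (hβ : 0 ≤ β) (hJ : J ⊆ α • A + β • B) :
    volume J ≤ ENNReal.ofReal α * volume A + ENNReal.ofReal β * volume B := by
  rcases A.eq_empty_or_nonempty with rfl | hAn
  · simp_all
  rcases B.eq_empty_or_nonempty with rfl | hBn
  · simp_all
  have h1 := sub_nonneg.2 <| csInf_le_csSup hAn hAb.bddBelow hAb.bddAbove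
  have h2 := sub_nonneg.2 <| csInf_le_csSup hBn hBb.bddBelow hBb.bddAbove
  rw [hA.volume_eq_ofReal_sSup_sub_sInf hAb hAn, hB.volume_eq_ofReal_sSup_sub_sInf hBb hBn,
    ← ENNReal.ofReal_mul hα, ← ENNReal.ofReal_mul hβ, ← ENNReal.ofReal_add (by positivity)
    (by positivity)]
  have : α * (sSup A - sInf A) + β * (sSup B - sInf B) =
    (α * sSup A + β * sSup B) - (α * sInf A + β * sInf B) := by ring
  rw [this, ← Real.volume_Icc]
  refine measure_mono fun z hz => ?_
  obtain ⟨_, ⟨a, ha, rfl⟩, _, ⟨b, hb, rfl⟩, rfl⟩ := hJ hz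
  have := le_csSup hAb.bddAbove ha
  have := le_csSup hBb.bddAbove hb
  have := csInf_le hAb.bddBelow ha
  have := csInf_le hBb.bddBelow hb
  simp only [smul_eq_mul]
  constructor <;> gcongr

theorem Convex.preimage_prodMk_right {G : Type*} [NormedAddCommGroup G] [NormedSpace ℝ G]
    {C : Set (ℝ × G)} (hC : Convex ℝ C) (y : G) :
    Convex ℝ ((fun a : ℝ => (a, y)) ⁻¹' C) := by
  intro a ha b hb s t hs ht hst
  have := hC ha hb hs ht hst
  simpa [← add_smul, hst] using this

theorem Bornology.IsBounded.preimage_prodMk_right {G : Type*} [NormedAddCommGroup G]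
    {C : Set (ℝ × G)} (hC : Bornology.IsBounded C) (y : G) : Bornology.IsBounded ((fun a : ℝ => (a, y)) ⁻¹' C) :=
  hC.image_fst.subset fun a ha => ⟨(a, y), ha, rfl⟩

section
variable {G : Type*} [NormedAddCommGroup G] [NormedSpace ℝ G] [FiniteDimensional ℝ G]
  [MeasurableSpace G] [BorelSpace G] (μ : Measure G) [μ.IsAddHaarMeasure]

theorem Convex.lintegral_volume_fiber {C : Set (ℝ × G)} (hC : Convex ℝ C) :
    (volume.prod μ) C = ∫⁻ y, volume ((fun a : ℝ => (a, y)) ⁻¹' C) ∂μ := by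
  have hm := hC.nullMeasurableSet (volume.prod μ)
  rw [← lintegral_indicator_one₀ hm, lintegral_prod_symm (C.indicator 1) (aemeasurable_one.indicator₀ hm)]
  congr with y
  rw [← lintegral_indicator_one (hC.preimage_prodMk_right y).ordConnected.measurableSet]
  rfl

theorem Convex.aemeasurable_volume_fiber {C : Set (ℝ × G)} (hC : Convex ℝ C) :
    AEMeasurable (fun y => volume ((fun a : ℝ => (a, y)) ⁻¹' C)) μ := by
  have hm := hC.nullMeasurableSet (volume.prod μ)
  convert (aemeasurable_one.indicator₀ (f := 1) hm).lintegral_prod_left' using 2 with y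
  rw [← lintegral_indicator_one (hC.preimage_prodMk_right y).ordConnected.measurableSet]
  rfl

theorem Convex.prod_volume_add_segment_fst {C : Set (ℝ × G)} (hC : Convex ℝ C)
    (hb : Bornology.IsBounded C) (c : ℝ) :
    (volume.prod μ) (C + segment ℝ 0 (c, (0 : G))) =
      (volume.prod μ) C + ENNReal.ofReal |c| * μ (Prod.snd '' C) := by
  have hD : NullMeasurableSet (Prod.snd '' C) μ :=
    (hC.linear_image (LinearMap.snd ℝ ℝ G)).nullMeasurableSet μ
  have hseg : segment ℝ 0 (c, (0 : G)) = (fun a : ℝ => (a, (0 : G))) '' segment ℝ 0 c := by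
    have := image_segment ℝ (LinearMap.inl ℝ ℝ G).toAffineMap 0 c
    simpa [← Prod.zero_eq_mk] using this.symm
  rw [(hC.add (convex_segment _ _)).lintegral_volume_fiber μ, hC.lintegral_volume_fiber μ,
    ← lintegral_indicator_const₀ hD, ← lintegral_add_left' (hC.aemeasurable_volume_fiber μ)]
  congr with y
  have hfib : (fun a : ℝ => (a, y)) ⁻¹' (C + segment ℝ 0 (c, (0 : G))) =
      (fun a : ℝ => (a, y)) ⁻¹' C + segment ℝ 0 c := by
    rw [hseg]
    ext a
    constructor
    · rintro ⟨⟨a', y'⟩, h1, _, ⟨b, hb, rfl⟩, h⟩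
      simp only [Prod.mk_add_mk, add_zero, Prod.mk.injEq] at h
      obtain ⟨rfl, rfl⟩ := h
      exact ⟨a', h1, b, hb, rfl⟩
    · rintro ⟨a', h1, b, hb, rfl⟩
      exact ⟨(a', y), h1, (b, 0), ⟨b, hb, rfl⟩, by simp⟩
  rw [hfib]
  by_cases hy : y ∈ Prod.snd '' C
  · rw [Set.indicator_of_mem hy, (hC.preimage_prodMk_right y).volume_add_segment
      (hb.preimage_prodMk_right y)]
    obtain ⟨⟨a, y⟩, h, rfl⟩ := hy
    exact ⟨a, h⟩
  · have : (fun a : ℝ => (a, y)) ⁻¹' C = ∅ :=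
      Set.eq_empty_of_forall_notMem fun a ha => hy ⟨_, ha, rfl⟩
    simp [Set.indicator_of_notMem hy, this]

theorem Convex.prod_volume_add_segment {C : Set (ℝ × G)} (hC : Convex ℝ C)
    (hb : Bornology.IsBounded C) (d : G) :
    (volume.prod μ) (C + segment ℝ 0 ((1 : ℝ), d)) =
      (volume.prod μ) C + μ ((fun z : ℝ × G => z.2 - z.1 • d) '' C) := by
  let T : (ℝ × G) →ₗ[ℝ] ℝ × G :=
    (LinearMap.fst ℝ ℝ G).prod (LinearMap.snd ℝ ℝ G - (LinearMap.fst ℝ ℝ G).smulRight d)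
  let T' : (ℝ × G) →ₗ[ℝ] ℝ × G :=
    (LinearMap.fst ℝ ℝ G).prod (LinearMap.snd ℝ ℝ G + (LinearMap.fst ℝ ℝ G).smulRight d)
  let e : (ℝ × G) ≃L[ℝ] ℝ × G := (LinearEquiv.ofLinearMap T T' (by ext <;> simp [T, T'])
    (by ext <;> simp [T, T'])).toContinuousLinearEquiv
  have hTe : ∀ z, e z = (z.1, z.2 - z.1 • d) := fun z => rfl
  have hmp : MeasurePreserving e (volume.prod μ) (volume.prod μ) := by
    refine (MeasurePreserving.id volume).skew_product (g := fun (a : ℝ) (q : G) => q - a • d)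
      (by unfold Function.uncurry; fun_prop) (.of_forall fun a => ?_)
    simpa [sub_eq_add_neg] using map_add_right_eq_self μ (-(a • d))
  have himg : ∀ A : Set (ℝ × G), (volume.prod μ) (e '' A) = (volume.prod μ) A := fun A => by
    have := hmp.measure_preimage_equiv (f := e.toHomeomorph.toMeasurableEquiv) (e '' A)
    rw [← this]
    congr 1
    exact Set.preimage_image_eq A e.injective
  have hseg : e '' segment ℝ 0 ((1 : ℝ), d) = segment ℝ 0 ((1 : ℝ), (0 : G)) := by
    have := image_segment ℝ (e : (ℝ × G) →ₗ[ℝ] ℝ × G).toAffineMap 0 ((1 : ℝ), d)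
    simpa [hTe, ← Prod.zero_eq_mk] using this
  rw [← himg, Set.image_add, hseg, Convex.prod_volume_add_segment_fst (C := e '' C) μ
    (hC.linear_image e.toLinearMap) (e.lipschitz.isBounded_image hb), himg, Set.image_image]
  simp [hTe]
end

theorem isBounded_preimage_prodMk_convexHull {ι H : Type*} [NormedAddCommGroup H]
    [NormedSpace ℝ H] {a : ι → ℝ}
    (ha : Bornology.IsBounded (Set.range a)) (y : ι → H) (q : H) : Bornology.IsBounded
      ((fun r : ℝ => (r, q)) ⁻¹' convexHull ℝ (Set.range fun i => (a i, y i))) := by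
  refine (isBounded_convexHull.2 ha).subset fun r hr => ?_
  have : r ∈ LinearMap.fst ℝ ℝ H '' convexHull ℝ (Set.range fun i => (a i, y i)) :=
    ⟨(r, q), hr, rfl⟩
  rw [LinearMap.image_convexHull, ← Set.range_comp] at this
  exact this

section
variable {H : Type*} [NormedAddCommGroup H] [NormedSpace ℝ H] [FiniteDimensional ℝ H]
  [MeasurableSpace H] [BorelSpace H] (μ : Measure H) [μ.IsAddHaarMeasure]

theorem prod_volume_convexHull_range_le {ι : Type*} {a b : ι → ℝ} (y : ι → H)
    (ha : Bornology.IsBounded (Set.range a)) (hb : Bornology.IsBounded (Set.range b))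
    {α β : ℝ} (hα : 0 ≤ α) (hβ : 0 ≤ β) :
    (volume.prod μ) (convexHull ℝ (Set.range fun i => (α * a i + β * b i, y i))) ≤
      ENNReal.ofReal α * (volume.prod μ) (convexHull ℝ (Set.range fun i => (a i, y i))) +
      ENNReal.ofReal β * (volume.prod μ) (convexHull ℝ (Set.range fun i => (b i, y i))) := by
  have hA := convex_convexHull ℝ (Set.range fun i => (a i, y i))
  have hB := convex_convexHull ℝ (Set.range fun i => (b i, y i))
  rw [(convex_convexHull ℝ _).lintegral_volume_fiber μ, hA.lintegral_volume_fiber μ,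
    hB.lintegral_volume_fiber μ, ← lintegral_const_mul'' _ (hA.aemeasurable_volume_fiber μ),
    ← lintegral_const_mul'' _ (hB.aemeasurable_volume_fiber μ),
    ← lintegral_add_left' ((hA.aemeasurable_volume_fiber μ).const_mul _)]
  refine lintegral_mono fun q => Convex.volume_le_of_subset_smul_add_smul
    (hA.preimage_prodMk_right q) (hB.preimage_prodMk_right q)
    (isBounded_preimage_prodMk_convexHull ha y q) (isBounded_preimage_prodMk_convexHull hb y q)
    hα hβ fun r hr => ?_
  let X : Set (ℝ × ℝ × H) := convexHull ℝ (Set.range fun i => (a i, b i, y i))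
  let fst : (ℝ × ℝ × H) →ₗ[ℝ] ℝ := LinearMap.fst ℝ ℝ (ℝ × H)
  let snd : (ℝ × ℝ × H) →ₗ[ℝ] ℝ := LinearMap.fst ℝ ℝ H ∘ₗ LinearMap.snd ℝ ℝ (ℝ × H)
  let base : (ℝ × ℝ × H) →ₗ[ℝ] H := LinearMap.snd ℝ ℝ H ∘ₗ LinearMap.snd ℝ ℝ (ℝ × H)
  have himage : ∀ f : (ℝ × ℝ × H) →ₗ[ℝ] ℝ, (f.prod base) '' X =
      convexHull ℝ (Set.range fun i => (f (a i, b i, y i), y i)) := fun f => by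
    rw [LinearMap.image_convexHull, ← Set.range_comp]
    rfl
  have hr' : (r, q) ∈ ((α • fst + β • snd).prod base) '' X := by rw [himage]; exact hr
  obtain ⟨z, hz, hzr⟩ := hr'
  have hzq : base z = q := congrArg Prod.snd hzr
  have hA' : (fst z, q) ∈ convexHull ℝ (Set.range fun i => (a i, y i)) :=
    hzq ▸ (himage fst).subset ⟨z, hz, rfl⟩
  have hB' : (snd z, q) ∈ convexHull ℝ (Set.range fun i => (b i, y i)) :=
    hzq ▸ (himage snd).subset ⟨z, hz, rfl⟩
  exact ⟨_, ⟨_, hA', rfl⟩, _, ⟨_, hB', rfl⟩, congrArg Prod.fst hzr⟩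

theorem convexOn_prod_volume_convexHull_range {ι V : Type*} [AddCommGroup V] [Module ℝ V]
    {a : V → ι → ℝ} {y : ι → H}
    (hb : ∀ p, Bornology.IsBounded (convexHull ℝ (Set.range fun i => (a p i, y i))))
    (ha : ∀ ⦃α β : ℝ⦄, α + β = 1 → ∀ p q i, a (α • p + β • q) i = α * a p i + β * a q i) :
    ConvexOn ℝ Set.univ fun p =>
      ((volume.prod μ) (convexHull ℝ (Set.range fun i => (a p i, y i)))).toReal := by
  refine ⟨convex_univ, fun p _ q _ α β hα hβ hαβ => ?_⟩
  have ha' : ∀ p, Bornology.IsBounded (Set.range (a p)) := fun p =>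
    (isBounded_convexHull.1 (hb p)).image_fst.subset <| by
      rintro _ ⟨i, rfl⟩
      exact ⟨_, ⟨i, rfl⟩, rfl⟩
  have hfin : ∀ (γ : ℝ) p, ENNReal.ofReal γ *
      (volume.prod μ) (convexHull ℝ (Set.range fun i => (a p i, y i))) ≠ ⊤ := fun γ p =>
    ENNReal.mul_ne_top ENNReal.ofReal_ne_top (hb p).measure_lt_top.ne
  have hle := prod_volume_convexHull_range_le μ y (ha' p) (ha' q) hα hβ
  simp only [← ha hαβ] at hle
  refine (ENNReal.toReal_mono (ENNReal.add_ne_top.2 ⟨hfin α p, hfin β q⟩) hle).trans_eq ?_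
  rw [ENNReal.toReal_add (hfin α p) (hfin β q), ENNReal.toReal_mul, ENNReal.toReal_mul,
    ENNReal.toReal_ofReal hα, ENNReal.toReal_ofReal hβ, smul_eq_mul, smul_eq_mul]
end

/-- Inclusion–exclusion for the mixed volume of `K[n-1]` and `L`. -/
theorem mixedVol_succ_eq_sum (m : ℕ) (K L : Set (EuclideanSpace ℝ (Fin (m + 1)))) :
    mixedVol (m + 1) (fun j => if (j : ℕ) < m + 1 - 1 then K else L) =
      (((m + 1).factorial : ℝ))⁻¹ * ∑ k ∈ Finset.range (m + 1), ((-1 : ℝ) ^ (m - k) * m.choose k) *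
        ((volume ((∑ _i ∈ Finset.range k, K) + L)).toReal -
          (volume (∑ _i ∈ Finset.range k, K)).toReal) := by
  set F : Fin (m + 1) → Set (EuclideanSpace ℝ (Fin (m + 1))) :=
    fun j => if (j : ℕ) < m + 1 - 1 then K else L with hF
  have huniv : (Finset.univ : Finset (Fin (m + 1))) =
      insert (Fin.last m) (Finset.univ.map Fin.castSuccEmb) := by
    ext i; cases i using Fin.lastCases <;> simp
  have hlast : Fin.last m ∉ (Finset.univ.map Fin.castSuccEmb : Finset (Fin (m + 1))) := by simp
  have hsum : ∀ S ∈ (Finset.univ.map Fin.castSuccEmb : Finset (Fin (m + 1))).powerset,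
      ∑ i ∈ S, F i = ∑ _i ∈ Finset.range S.card, K := fun S hS => by
    rw [Finset.sum_const, Finset.card_range, ← Finset.sum_const]
    refine Finset.sum_congr rfl fun i hi => ?_
    have := Finset.mem_powerset.1 hS hi
    simp only [Finset.mem_map, Finset.mem_univ, true_and] at this
    obtain ⟨j, rfl⟩ := this
    simp [hF]
  unfold mixedVol
  congr 1
  rw [← Finset.powerset_univ, huniv, Finset.sum_powerset_insert hlast, ← Finset.sum_add_distrib]
  have hterm : ∀ S ∈ (Finset.univ.map Fin.castSuccEmb : Finset (Fin (m + 1))).powerset,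
      (-1 : ℝ) ^ (m + 1 - S.card) * (volume (∑ i ∈ S, F i)).toReal +
        (-1 : ℝ) ^ (m + 1 - (insert (Fin.last m) S).card) *
          (volume (∑ i ∈ insert (Fin.last m) S, F i)).toReal =
      (-1 : ℝ) ^ (m - S.card) * ((volume ((∑ _i ∈ Finset.range S.card, K) + L)).toReal -
          (volume (∑ _i ∈ Finset.range S.card, K)).toReal) := fun S hS => by
    have hcard : S.card ≤ m := by
      simpa using Finset.card_le_card (Finset.mem_powerset.1 hS)
    have hnot : Fin.last m ∉ S := fun h => hlast (Finset.mem_powerset.1 hS h)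
    have hFl : F (Fin.last m) = L := by simp [hF]
    rw [Finset.card_insert_of_notMem hnot, Finset.sum_insert hnot, hsum S hS, hFl, add_comm L,
      Nat.add_sub_add_right, Nat.sub_add_comm hcard, pow_succ]
    ring
  rw [Finset.sum_congr rfl hterm]
  rw [Finset.sum_powerset_apply_card (fun k => (-1 : ℝ) ^ (m - k) *
    ((volume ((∑ _i ∈ Finset.range k, K) + L)).toReal -
          (volume (∑ _i ∈ Finset.range k, K)).toReal))]
  simp only [Finset.card_map, Finset.card_univ, Fintype.card_fin, nsmul_eq_mul]
  exact Finset.sum_congr rfl fun k _ => by ring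

theorem sum_neg_one_pow_mul_choose_mul_pow (m : ℕ) :
    ∑ k ∈ Finset.range (m + 1), ((-1 : ℝ) ^ (m - k) * m.choose k) * (k : ℝ) ^ m =
      m.factorial := by
  have h := congrFun (fwdDiff_iter_eq_factorial (R := ℝ) (n := m)) 0
  rw [fwdDiff_iter_eq_sum_shift] at h
  simpa using h

theorem Convex.sum_range_eq_smul {E : Type*} [AddCommGroup E] [Module ℝ E] {K : Set E}
    (hK : Convex ℝ K) (hne : K.Nonempty) (k : ℕ) : ∑ _i ∈ Finset.range k, K = (k : ℝ) • K := by
  induction k with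
  | zero => simp [Set.zero_smul_set hne]
  | succ k ih => rw [Finset.sum_range_succ, ih, Nat.cast_succ,
      hK.add_smul k.cast_nonneg zero_le_one, one_smul]

/-- If adding the set `L` to a bounded convex set increases the volume by `κ` times the measure of
its linear image under `P`, then this increase is `n V(K[n-1], L)`. -/
theorem mul_mixedVol_eq_toReal {G : Type*} [NormedAddCommGroup G] [NormedSpace ℝ G]
    [FiniteDimensional ℝ G] [MeasurableSpace G] [BorelSpace G] (μ : Measure G)
    [μ.IsAddHaarMeasure] {n : ℕ} (hn : Module.finrank ℝ G + 1 = n)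
    (P : EuclideanSpace ℝ (Fin n) →ₗ[ℝ] G) {κ : ENNReal} (hκ : κ ≠ ⊤)
    {L : Set (EuclideanSpace ℝ (Fin n))}
    (hL : ∀ K, Convex ℝ K → Bornology.IsBounded K →
      volume (K + L) = volume K + κ * μ (P '' K))
    {K : Set (EuclideanSpace ℝ (Fin n))} (hK : Convex ℝ K) (hKb : Bornology.IsBounded K)
    (hne : K.Nonempty ∨ n ≠ 1) :
    (n : ℝ) * mixedVol n (fun j => if (j : ℕ) < n - 1 then K else L) =
      (κ * μ (P '' K)).toReal := by
  obtain ⟨m, rfl⟩ : ∃ m, n = m + 1 := ⟨_, hn.symm⟩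
  have hG : Module.finrank ℝ G = m := by omega
  have hfin : ∀ A : Set (EuclideanSpace ℝ (Fin (m + 1))), Bornology.IsBounded A →
      κ * μ (P '' A) ≠ ⊤ := fun A hA =>
    ENNReal.mul_ne_top hκ
      (P.toContinuousLinearMap.lipschitz.isBounded_image hA).measure_lt_top.ne
  have key : ∀ k : ℕ, (volume ((∑ _i ∈ Finset.range k, K) + L)).toReal -
      (volume (∑ _i ∈ Finset.range k, K)).toReal = (k : ℝ) ^ m * (κ * μ (P '' K)).toReal := by
    intro k
    rcases K.eq_empty_or_nonempty with rfl | hK₀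
    · cases k with
      | zero =>
        have hm : 0 < m := by
          rcases hne with h | h
          · simp at h
          · omega
        have : Nontrivial G := Module.nontrivial_of_finrank_pos (R := ℝ) (hG ▸ hm)
        have h0 := hL {0} (convex_singleton 0) Bornology.isBounded_singleton
        simp only [Set.image_singleton, map_zero, measure_singleton, mul_zero, add_zero] at h0
        rw [Set.singleton_zero, zero_add] at h0
        rw [Finset.sum_range_zero, zero_add, h0, ← Set.singleton_zero, measure_singleton]
        simp
      | succ k => simp
    have hb : Bornology.IsBounded ((k : ℝ) • K) := hKb.smul₀ (k : ℝ)
    rw [hK.sum_range_eq_smul hK₀, hL _ (hK.smul _) hb,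
      ENNReal.toReal_add hb.measure_lt_top.ne (hfin _ hb), add_sub_cancel_left,
      image_smul_set, Measure.addHaar_smul, hG]
    simp only [ENNReal.toReal_mul]
    rw [ENNReal.toReal_ofReal (abs_nonneg _), abs_of_nonneg (by positivity)]
    ring
  rw [mixedVol_succ_eq_sum]
  simp_rw [key, ← mul_assoc]
  rw [← Finset.sum_mul, sum_neg_one_pow_mul_choose_mul_pow, Nat.factorial_succ]
  have := Nat.factorial_ne_zero m
  push_cast
  field_simp

theorem exists_prod_orthogonal_equiv {E : Type*} [NormedAddCommGroup E] [InnerProductSpace ℝ E]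
    [FiniteDimensional ℝ E] {u : E} (hu : u ≠ 0) :
    ∃ e : (ℝ × (Submodule.span ℝ {u})ᗮ) ≃L[ℝ] E, ∀ a h, e (a, h) = a • u + h := by
  refine ⟨(((LinearEquiv.toSpanNonzeroSingleton ℝ E u hu).prodCongr (.refl ℝ _)).trans
    (Submodule.prodEquivOfIsCompl (Submodule.span ℝ {u}) _
      (Submodule.isCompl_orthogonal _))).toContinuousLinearEquiv, fun a h => ?_⟩
  simp [LinearEquiv.toSpanNonzeroSingleton_apply]

section
variable {G E : Type*} [NormedAddCommGroup G] [NormedSpace ℝ G]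
  [MeasurableSpace G] [BorelSpace G] [NormedAddCommGroup E] [NormedSpace ℝ E]
  [FiniteDimensional ℝ E] [MeasurableSpace E] [BorelSpace E]

theorem ContinuousLinearEquiv.exists_measure_image_eq (e : G ≃L[ℝ] E) (μ : Measure G)
    [μ.IsAddHaarMeasure] (ν : Measure E) [ν.IsAddHaarMeasure] :
    ∃ κ : ENNReal, κ ≠ ⊤ ∧ ∀ A : Set G, ν (e '' A) = κ * μ A := by
  refine ⟨Measure.addHaarScalarFactor ν (μ.map e), ENNReal.coe_ne_top, fun A => ?_⟩
  conv_lhs => rw [Measure.isAddLeftInvariant_eq_smul ν (μ.map e)]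
  have : μ.map e (e '' A) = μ A := by
    have h := e.toHomeomorph.toMeasurableEquiv.map_apply (μ := μ) (e '' A)
    exact h.trans (congrArg μ (Set.preimage_image_eq A e.injective))
  rw [Measure.smul_apply, this]
  rfl

theorem ContinuousLinearEquiv.exists_measure_add_segment_eq [FiniteDimensional ℝ G]
    (e : (ℝ × G) ≃L[ℝ] E)
    (μ : Measure G) [μ.IsAddHaarMeasure] (ν : Measure E) [ν.IsAddHaarMeasure] :
    ∃ κ : ENNReal, κ ≠ ⊤ ∧ ∀ K : Set E, Convex ℝ K → Bornology.IsBounded K →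
      (∀ c : ℝ, ν (K + segment ℝ 0 (e (c, 0))) = ν K + κ * ENNReal.ofReal |c| *
        μ ((LinearMap.snd ℝ ℝ G ∘ₗ e.symm.toLinearMap) '' K)) ∧
      ∀ d : G, ν (K + segment ℝ 0 (e (1, d))) = ν K + κ *
        μ (((LinearMap.snd ℝ ℝ G - (LinearMap.fst ℝ ℝ G).smulRight d) ∘ₗ
          e.symm.toLinearMap) '' K) := by
  obtain ⟨κ, hκ, h⟩ := e.exists_measure_image_eq (volume.prod μ) ν
  refine ⟨κ, hκ, fun K hK hb => ?_⟩
  have hC : Convex ℝ (e.symm '' K) := hK.linear_image e.symm.toLinearMap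
  have hCb : Bornology.IsBounded (e.symm '' K) := e.symm.lipschitz.isBounded_image hb
  have heC : e '' (e.symm '' K) = K := by simp [Set.image_image]
  have hseg : ∀ z, K + segment ℝ 0 (e z) = e '' (e.symm '' K + segment ℝ 0 z) := fun z => by
    have := image_segment ℝ (e : (ℝ × G) →ₗ[ℝ] E).toAffineMap 0 z
    rw [Set.image_add, heC]
    congr 1
    simpa using this.symm
  have hK' : ν K = κ * (volume.prod μ) (e.symm '' K) := by rw [← h, heC]
  constructor
  · intro c
    rw [hseg, h, hC.prod_volume_add_segment_fst μ hCb, mul_add, ← hK', Set.image_image, mul_assoc]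
    rfl
  · intro d
    rw [hseg, h, hC.prod_volume_add_segment μ hCb, mul_add, ← hK', Set.image_image]
    rfl
end

theorem isBounded_range_add_smul {ι E : Type*} [NormedAddCommGroup E] [NormedSpace ℝ E]
    {x : ι → E} {l : ι → ℝ} (hx : Bornology.IsBounded (Set.range x))
    (hl : Bornology.IsBounded (Set.range l)) (t : ℝ) (u : E) :
    Bornology.IsBounded (Set.range fun i => x i + (l i * t) • u) := by
  obtain ⟨A, hA⟩ := hx.exists_norm_le
  obtain ⟨B, hB⟩ := hl.exists_norm_le
  refine isBounded_iff_forall_norm_le.2 ⟨A + B * |t| * ‖u‖, ?_⟩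
  rintro _ ⟨i, rfl⟩
  refine (norm_add_le _ _).trans (add_le_add (hA _ ⟨i, rfl⟩) ?_)
  rw [norm_smul, norm_mul, Real.norm_eq_abs t]
  gcongr
  exact hB _ ⟨i, rfl⟩

theorem convexOn_mixedVol_lps_segment {n : ℕ} {ι : Type*}
    {x : ι → EuclideanSpace ℝ (Fin n)} {l : ι → ℝ}
    (hx : Bornology.IsBounded (Set.range x)) (hl : Bornology.IsBounded (Set.range l))
    {u : EuclideanSpace ℝ (Fin n)} (hu : u ≠ 0)
    {w : EuclideanSpace ℝ (Fin n)} (hw : ⟪w, u⟫ = 0) (r r' : ℝ)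
    (hne : Nonempty ι ∨ n ≠ 1) :
    ConvexOn ℝ Set.univ (fun p : ℝ × ℝ =>
      (n : ℝ) * mixedVol n (fun j =>
        if (j : ℕ) < n - 1 then
          convexHull ℝ (Set.range fun i : ι => x i + (l i * p.1) • u)
        else segment ℝ 0 (w + ((1 - p.2) * r + p.2 * r') • u))) := by
  set K : ℝ → Set (EuclideanSpace ℝ (Fin n)) :=
    fun t => convexHull ℝ (Set.range fun i : ι => x i + (l i * t) • u) with hKdef
  set g : ℝ → ℝ := fun s => (1 - s) * r + s * r' with hg
  have hK : ∀ t, Convex ℝ (K t) := fun t => convex_convexHull ℝ _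
  have hKb : ∀ t, Bornology.IsBounded (K t) := fun t =>
    isBounded_convexHull.2 (isBounded_range_add_smul hx hl t u)
  have hKne : ∀ t, (K t).Nonempty ∨ n ≠ 1 := fun t =>
    hne.imp_left fun h => convexHull_nonempty_iff.2 (h.elim fun i => ⟨_, i, rfl⟩)
  have hgaff : ∀ {α β : ℝ}, α + β = 1 → ∀ s s', g (α * s + β * s') = α * g s + β * g s' := by
    intro α β h s s'
    obtain rfl : β = 1 - α := by linarith
    simp only [hg]
    ring
  rcases eq_or_ne w 0 with rfl | hw0
  · obtain ⟨e, he⟩ := exists_prod_orthogonal_equiv hu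
    obtain ⟨κ, hκ, hvol⟩ := e.exists_measure_add_segment_eq volume volume
    have hfin : Module.finrank ℝ (Submodule.span ℝ {u})ᗮ + 1 = n := by
      simpa [add_comm] using e.toLinearEquiv.finrank_eq
    set P := LinearMap.snd ℝ ℝ (Submodule.span ℝ {u})ᗮ ∘ₗ e.symm.toLinearMap with hP
    have hPu : P u = 0 := by
      have : e.symm u = (1, 0) := by rw [e.symm_apply_eq, he]; simp
      simp [hP, this]
    have hPK : ∀ t, P '' K t = convexHull ℝ (Set.range fun i => P (x i)) := fun t => by
      rw [LinearMap.image_convexHull, ← Set.range_comp]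
      congr 2
      ext i
      simp [hPu]
    set M := κ.toReal * (volume (convexHull ℝ (Set.range fun i => P (x i)))).toReal with hM
    have hval : ∀ t s, (n : ℝ) * mixedVol n (fun j =>
        if (j : ℕ) < n - 1 then K t else segment ℝ 0 (0 + g s • u)) = |g s| * M := by
      intro t s
      have hseg : (0 : EuclideanSpace ℝ (Fin n)) + g s • u = e (g s, 0) := by simp [he]
      rw [hseg, mul_mixedVol_eq_toReal volume hfin P (ENNReal.mul_ne_top hκ ENNReal.ofReal_ne_top)
        (fun A hA hAb => (hvol A hA hAb).1 (g s)) (hK t) (hKb t) (hKne t), hPK, hM,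
        ENNReal.toReal_mul, ENNReal.toReal_mul, ENNReal.toReal_ofReal (abs_nonneg _)]
      ring
    refine ConvexOn.congr (f := fun p : ℝ × ℝ => |g p.2| * M) ?_ fun p _ => (hval p.1 p.2).symm
    refine ⟨convex_univ, fun p _ q _ α β hα hβ hαβ => ?_⟩
    simp only [Prod.snd_add, Prod.smul_snd, smul_eq_mul, hgaff hαβ]
    have hM0 : 0 ≤ M := by positivity
    calc |α * g p.2 + β * g q.2| * M ≤ (α * |g p.2| + β * |g q.2|) * M := by
          gcongr
          refine (abs_add_le _ _).trans_eq ?_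
          rw [abs_mul, abs_mul, abs_of_nonneg hα, abs_of_nonneg hβ]
      _ = _ := by ring
  · obtain ⟨e₁, he₁⟩ := exists_prod_orthogonal_equiv hw0
    let u' : (Submodule.span ℝ {w})ᗮ := ⟨u, Submodule.mem_orthogonal_singleton_iff_inner_right.2 hw⟩
    have hu' : u' ≠ 0 := fun h => hu (congrArg Subtype.val h)
    obtain ⟨e₂, he₂⟩ := exists_prod_orthogonal_equiv hu'
    let H := (Submodule.span ℝ {u'})ᗮ
    let e : (ℝ × ℝ × H) ≃L[ℝ] EuclideanSpace ℝ (Fin n) :=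
      ((ContinuousLinearEquiv.refl ℝ ℝ).prodCongr e₂).trans e₁
    have he : ∀ a b, e (a, b, 0) = a • w + b • u := fun a b => by
      simp [e, he₁, he₂, u']
    obtain ⟨κ, hκ, hvol⟩ := e.exists_measure_add_segment_eq (volume.prod volume) volume
    have hfin : Module.finrank ℝ (ℝ × H) + 1 = n := by
      have := e.toLinearEquiv.finrank_eq
      rw [Module.finrank_prod] at this
      simpa [add_comm] using this
    let P : ℝ → EuclideanSpace ℝ (Fin n) →ₗ[ℝ] ℝ × H := fun c =>
      (LinearMap.snd ℝ ℝ (ℝ × H) - (LinearMap.fst ℝ ℝ (ℝ × H)).smulRight (c, 0)) ∘ₗ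
        e.symm.toLinearMap
    let a : ℝ × ℝ → ι → ℝ := fun p i =>
      (e.symm (x i)).2.1 + l i * p.1 - (e.symm (x i)).1 * g p.2
    let y : ι → H := fun i => (e.symm (x i)).2.2
    have hPx : ∀ p : ℝ × ℝ, ∀ i, P (g p.2) (x i + (l i * p.1) • u) = (a p i, y i) := by
      intro p i
      have : e.symm u = (0, 1, 0) := by rw [e.symm_apply_eq, he]; simp
      ext <;> simp [P, this, a, y]
    have hPK : ∀ p : ℝ × ℝ, P (g p.2) '' K p.1 =
        convexHull ℝ (Set.range fun i => (a p i, y i)) := fun p => by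
      rw [LinearMap.image_convexHull, ← Set.range_comp]
      congr 2
      exact funext (hPx p)
    have hval : ∀ p : ℝ × ℝ, (n : ℝ) * mixedVol n (fun j =>
        if (j : ℕ) < n - 1 then K p.1 else segment ℝ 0 (w + g p.2 • u)) =
        (κ * (volume.prod volume) (convexHull ℝ (Set.range fun i => (a p i, y i)))).toReal := by
      intro p
      have hseg : w + g p.2 • u = e (1, g p.2, 0) := by simp [he]
      rw [hseg, mul_mixedVol_eq_toReal (volume.prod volume) hfin (P (g p.2)) hκ
        (fun A hA hAb => (hvol A hA hAb).2 (g p.2, 0)) (hK p.1) (hKb p.1) (hKne p.1), hPK]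
    have hbdd : ∀ p, Bornology.IsBounded (convexHull ℝ (Set.range fun i => (a p i, y i))) :=
      fun p => hPK p ▸ (P (g p.2)).toContinuousLinearMap.lipschitz.isBounded_image (hKb p.1)
    have haff : ∀ ⦃α β : ℝ⦄, α + β = 1 → ∀ p q i,
        a (α • p + β • q) i = α * a p i + β * a q i := by
      intro α β h p q i
      simp only [a, Prod.fst_add, Prod.snd_add, Prod.smul_fst, Prod.smul_snd, smul_eq_mul, hgaff h]
      linear_combination -(e.symm (x i)).2.1 * h
    refine ConvexOn.congr (f := fun p : ℝ × ℝ => κ.toReal * ((volume.prod volume)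
      (convexHull ℝ (Set.range fun i => (a p i, y i)))).toReal) ?_
      fun p _ => ENNReal.toReal_mul.symm.trans (hval p).symm
    exact (convexOn_prod_volume_convexHull_range volume hbdd haff).smul ENNReal.toReal_nonneg

/-- (Joint convexity of mixed volumes along linear parameter systems with a moving
segment.) For the linear parameter system `K(t) = conv{x_j + λ_j t u}` and segments
`[0, w + ((1−s)r + s r')u]` with `w ⊥ u`, the function
`(t,s) ↦ n·V(K(t)[n−1],[0, w + ((1−s)r+s r')u])` is jointly convex on `I × [0,1]`. -/
theorem mixedVol_lps_segment_jointly_convex {n : ℕ} {ι : Type*}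
    (x : ι → EuclideanSpace ℝ (Fin n)) (l : ι → ℝ)
    (hx : Bornology.IsBounded (Set.range x)) (hl : Bornology.IsBounded (Set.range l))
    (u : EuclideanSpace ℝ (Fin n)) (hu : ‖u‖ = 1)
    (w : EuclideanSpace ℝ (Fin n)) (hw : ⟪w, u⟫ = 0) (r r' : ℝ)
    (I : Set ℝ) (hI : Convex ℝ I) :
    ConvexOn ℝ (I ×ˢ Set.Icc (0 : ℝ) 1) (fun p : ℝ × ℝ =>
      (n : ℝ) * mixedVol n (fun j =>
        if (j : ℕ) < n - 1 then
          convexHull ℝ (Set.range fun i : ι => x i + (l i * p.1) • u)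
        else segment ℝ 0 (w + ((1 - p.2) * r + p.2 * r') • u))) := by
  have hu0 : u ≠ 0 := norm_ne_zero_iff.1 (by simp [hu])
  have hdom : Convex ℝ (I ×ˢ Set.Icc (0 : ℝ) 1) := hI.prod (convex_Icc 0 1)
  by_cases hne : Nonempty ι ∨ n ≠ 1
  · exact (convexOn_mixedVol_lps_segment hx hl hu0 hw r r' hne).subset (Set.subset_univ _) hdom
  · obtain rfl : n = 1 := by tauto
    have := (convexOn_mixedVol_lps_segment (x := fun _ : Unit => 0) (l := fun _ => 0)
      (Set.finite_range _).isBounded (Set.finite_range _).isBounded hu0 hw r r'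
      (.inl inferInstance)).subset (Set.subset_univ _) hdom
    simpa using this
end
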